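/- Let M ≥ 1 be an integer, let α_k, β_k > 0 for k = 1,…,M, let m and l be nonnegative integers with l ≥ m, and suppose ∑_{k=1}^M α_k > m + (1/2)(M + 1/2) and λ ≥ π·∑_{k=1}^M β_k. Then ∫_0^∞ x^{2m}·J_{2l+1}(λx)·g_M(x) dx = (1/2) ∑_{s=0}^{l−m} (a_s^{(M)}/(2s)!) · (l+m+s)!/(l−m−s)! · (2/λ)^{2m+2s+1}. -/

import Mathlib

open MeasureTheory Real

/-- Bessel function of the first kind of nonnegative integer order `n`. -/
noncomputable def besselJ (n : ℕ) (x : ℝ) : ℝ :=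
  ∑' k : ℕ, (-1 : ℝ) ^ k / (Nat.factorial k * Nat.factorial (n + k)) * (x / 2) ^ (n + 2 * k)

/-- The product of reciprocal Gamma functions `∏_{k<M} 1/(Γ(α k + β k x) Γ(α k - β k x))`. -/
noncomputable def gammaProd (M : ℕ) (α β : ℕ → ℝ) (x : ℝ) : ℝ :=
  ∏ k ∈ Finset.range M, (Real.Gamma (α k + β k * x) * Real.Gamma (α k - β k * x))⁻¹

/-- The entire function `∑ (-y)^k / (k! (n+k)!)`, so that `J_n(x) = (x/2)^n · besselClifford n (x²/4)`. -/
noncomputable def besselClifford (n : ℕ) (y : ℝ) : ℝ :=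
  ∑' k : ℕ, (-1 : ℝ) ^ k / (Nat.factorial k * Nat.factorial (n + k)) * y ^ k

lemma norm_besselClifford_term_le (n k : ℕ) (y : ℝ) :
    ‖(-1 : ℝ) ^ k / (Nat.factorial k * Nat.factorial (n + k)) * y ^ k‖
      ≤ |y| ^ k / Nat.factorial k := by
  have h1 : (1 : ℝ) ≤ Nat.factorial (n + k) := by exact_mod_cast Nat.factorial_pos _
  have h2 : (0 : ℝ) < Nat.factorial k := by exact_mod_cast Nat.factorial_pos _
  rw [norm_mul, norm_div, norm_pow, norm_neg, norm_one, one_pow, norm_pow, Real.norm_eq_abs y,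
    Real.norm_of_nonneg (by positivity), div_mul_eq_mul_div, one_mul]
  gcongr
  exact le_mul_of_one_le_right h2.le h1

lemma summable_besselClifford (n : ℕ) (y : ℝ) :
    Summable fun k : ℕ => (-1 : ℝ) ^ k / (Nat.factorial k * Nat.factorial (n + k)) * y ^ k :=
  Summable.of_norm_bounded (Real.summable_pow_div_factorial |y|)
    fun k => norm_besselClifford_term_le n k y

lemma hasDerivAt_besselClifford (n : ℕ) (y : ℝ) :
    HasDerivAt (besselClifford n) (-besselClifford (n + 1) y) y := by
  set r : ℝ := |y| + 1 with hr
  have hr0 : 0 < r := by positivity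
  have hu : Summable fun k : ℕ => (k : ℝ) * r ^ (k - 1) / Nat.factorial k := by
    rw [← summable_nat_add_iff 1]
    refine (Real.summable_pow_div_factorial r).congr fun k => ?_
    rw [Nat.factorial_succ]
    have : (Nat.factorial k : ℝ) ≠ 0 := by positivity
    push_cast
    field_simp
  have key := hasDerivAt_tsum_of_isPreconnected (𝕜 := ℝ) (F := ℝ)
    (g := fun k z => (-1 : ℝ) ^ k / (Nat.factorial k * Nat.factorial (n + k)) * z ^ k)
    (g' := fun k z => (-1 : ℝ) ^ k / (Nat.factorial k * Nat.factorial (n + k))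
      * ((k : ℝ) * z ^ (k - 1)))
    (y := y) (y₀ := y) (t := Metric.ball 0 r) hu Metric.isOpen_ball
    (convex_ball _ _).isPreconnected
    (fun k z _ => (hasDerivAt_pow k z).const_mul _)
    (fun k z hz => ?_) ?_ (summable_besselClifford n y) ?_
  · refine key.congr_deriv (Eq.symm ?_)
    rw [Summable.tsum_eq_zero_add, besselClifford, ← tsum_neg]
    · simp only [Nat.cast_zero, zero_mul, mul_zero, zero_add]
      congr 1; ext k
      rw [Nat.factorial_succ, show n + 1 + k = n + (k + 1) by ring]
      have h1 : (Nat.factorial k : ℝ) ≠ 0 := by positivity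
      have h2 : (Nat.factorial (n + (k + 1)) : ℝ) ≠ 0 := by positivity
      push_cast
      field_simp
      rw [pow_succ]; simp [mul_comm]
    · rw [← summable_nat_add_iff 1]
      refine ((summable_besselClifford (n + 1) y).neg).congr fun k => ?_
      rw [Nat.factorial_succ, show n + 1 + k = n + (k + 1) by ring]
      have h1 : (Nat.factorial k : ℝ) ≠ 0 := by positivity
      have h2 : (Nat.factorial (n + (k + 1)) : ℝ) ≠ 0 := by positivity
      push_cast
      field_simp
      rw [pow_succ]; simp [mul_comm]
  · have h1 : (1 : ℝ) ≤ Nat.factorial (n + k) := by exact_mod_cast Nat.factorial_pos _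
    have h2 : (0 : ℝ) < Nat.factorial k := by exact_mod_cast Nat.factorial_pos _
    have hz' : |z| ≤ r := by
      have := Metric.mem_ball.mp hz
      rw [dist_zero_right, Real.norm_eq_abs] at this
      exact this.le
    rw [norm_mul, norm_div, norm_pow, norm_neg, norm_one, one_pow, norm_mul (k : ℝ), norm_pow,
      Real.norm_eq_abs z, Real.norm_of_nonneg (by positivity), Real.norm_of_nonneg (by positivity),
      div_mul_eq_mul_div, one_mul]
    gcongr
    exact le_mul_of_one_le_right h2.le h1
  · simp [hr]
  · simp [hr]

lemma besselClifford_recurrence (n : ℕ) (y : ℝ) :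
    besselClifford n y = (n + 1) * besselClifford (n + 1) y - y * besselClifford (n + 2) y := by
  have e1 := summable_besselClifford n y
  have e2 := summable_besselClifford (n + 1) y
  have e3 := summable_besselClifford (n + 2) y
  unfold besselClifford
  rw [e1.tsum_eq_zero_add, e2.tsum_eq_zero_add, mul_add, ← tsum_mul_left, ← tsum_mul_left,
    add_sub_assoc, ← Summable.tsum_sub]
  · congr 1
    · simp only [pow_zero, Nat.factorial_zero, add_zero, Nat.factorial_succ]
      have h1 : (Nat.factorial n : ℝ) ≠ 0 := by positivity
      push_cast
      field_simp
    · congr 1; ext k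
      rw [show n + 1 + (k + 1) = (n + (k + 1)) + 1 by ring,
        show n + 2 + k = (n + (k + 1)) + 1 by ring, Nat.factorial_succ (n + (k + 1)),
        Nat.factorial_succ k]
      have h1 : (Nat.factorial k : ℝ) ≠ 0 := by positivity
      have h2 : (Nat.factorial (n + (k + 1)) : ℝ) ≠ 0 := by positivity
      push_cast
      field_simp
      ring
  · exact ((summable_nat_add_iff 1).mpr e2).mul_left _
  · exact e3.mul_left _

lemma besselJ_eq (n : ℕ) (x : ℝ) :
    besselJ n x = (x / 2) ^ n * besselClifford n (x ^ 2 / 4) := by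
  rw [besselJ, besselClifford, ← tsum_mul_left]
  congr 1; ext k
  rw [pow_add, pow_mul, show (x / 2) ^ 2 = x ^ 2 / 4 by ring]
  ring

lemma besselJ_zero_zero : besselJ 0 0 = 1 := by
  rw [besselJ_eq, besselClifford, tsum_eq_single 0]
  · simp
  · intro k hk
    simp [hk]

lemma besselJ_succ_zero (n : ℕ) : besselJ (n + 1) 0 = 0 := by
  simp [besselJ_eq]

/-- `x J_n(x) + x J_{n+2}(x) = 2 (n+1) J_{n+1}(x)`. -/
lemma besselJ_recurrence (n : ℕ) (x : ℝ) :
    x * besselJ n x + x * besselJ (n + 2) x = 2 * (n + 1) * besselJ (n + 1) x := by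
  rw [besselJ_eq, besselJ_eq, besselJ_eq, besselClifford_recurrence n]
  ring

lemma hasDerivAt_besselClifford_comp (n : ℕ) (x : ℝ) :
    HasDerivAt (fun x => besselClifford n (x ^ 2 / 4))
      (-besselClifford (n + 1) (x ^ 2 / 4) * (x / 2)) x := by
  have h : HasDerivAt (fun x : ℝ => x ^ 2 / 4) (x / 2) x := by
    refine ((hasDerivAt_pow 2 x).div_const 4).congr_deriv ?_
    norm_num; ring
  exact (hasDerivAt_besselClifford n (x ^ 2 / 4)).comp x h

lemma hasDerivAt_besselJ_zero (x : ℝ) : HasDerivAt (besselJ 0) (-besselJ 1 x) x := by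
  have h := hasDerivAt_besselClifford_comp 0 x
  have e : besselJ 0 = fun x => besselClifford 0 (x ^ 2 / 4) := by
    ext x; simp [besselJ_eq]
  rw [e]
  refine h.congr_deriv ?_
  rw [besselJ_eq]; ring

lemma hasDerivAt_besselJ_succ (n : ℕ) (x : ℝ) :
    HasDerivAt (besselJ (n + 1)) ((besselJ n x - besselJ (n + 2) x) / 2) x := by
  have h := hasDerivAt_besselClifford_comp (n + 1) x
  have e : besselJ (n + 1) = fun x => (x / 2) ^ (n + 1) * besselClifford (n + 1) (x ^ 2 / 4) := by
    ext x; rw [besselJ_eq]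
  have h2 : HasDerivAt (fun x : ℝ => (x / 2) ^ (n + 1)) ((n + 1) * (x / 2) ^ n * (1 / 2)) x := by
    refine (((hasDerivAt_id x).div_const 2).pow (n + 1)).congr_deriv ?_
    simp
  rw [e]
  refine (h2.mul h).congr_deriv ?_
  rw [besselJ_eq, besselJ_eq, besselClifford_recurrence n]
  ring

lemma continuous_besselJ (n : ℕ) : Continuous (besselJ n) := by
  cases n with
  | zero => exact continuous_iff_continuousAt.mpr fun x => (hasDerivAt_besselJ_zero x).continuousAt
  | succ n =>
    exact continuous_iff_continuousAt.mpr fun x => (hasDerivAt_besselJ_succ n x).continuousAt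

/-- The energy `x (J₀² + J₁²) - J₀ J₁`, damped by `exp (1/x)`, is nonincreasing on `[1, ∞)`. -/
lemma besselJ_energy_bound (x : ℝ) (hx : 1 ≤ x) :
    x * (besselJ 0 x ^ 2 + besselJ 1 x ^ 2) ≤
      2 * ((besselJ 0 1 ^ 2 + besselJ 1 1 ^ 2 - besselJ 0 1 * besselJ 1 1) * rexp 1) := by
  set E : ℝ → ℝ := fun x =>
    (x * (besselJ 0 x ^ 2 + besselJ 1 x ^ 2) - besselJ 0 x * besselJ 1 x) * rexp (x⁻¹) with hE
  have hd : ∀ x : ℝ, 1 ≤ x → HasDerivAt E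
      (((besselJ 0 x * besselJ 1 x) / x
        - (x * (besselJ 0 x ^ 2 + besselJ 1 x ^ 2) - besselJ 0 x * besselJ 1 x) / x ^ 2)
          * rexp (x⁻¹)) x := by
    intro x hx
    have hx0 : x ≠ 0 := by positivity
    have h0 := hasDerivAt_besselJ_zero x
    have h1 := hasDerivAt_besselJ_succ 0 x
    have hr := besselJ_recurrence 0 x
    simp only [zero_add, Nat.cast_zero] at h1 hr
    have h2 : besselJ 2 x = 2 * besselJ 1 x / x - besselJ 0 x := by
      field_simp; linarith
    rw [h2] at h1
    have hexp := (hasDerivAt_inv hx0).exp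
    refine ((((hasDerivAt_id x).mul ((h0.pow 2).add (h1.pow 2))).sub
      (h0.mul h1)).mul hexp).congr_deriv ?_
    simp
    field_simp
    ring
  have hanti : AntitoneOn E (Set.Ici 1) := by
    refine antitoneOn_of_hasDerivWithinAt_nonpos (convex_Ici 1)
      (fun x hx => (hd x hx).continuousAt.continuousWithinAt)
      (fun x hx => (hd x ?_).hasDerivWithinAt) fun x hx => ?_
    · rw [interior_Ici] at hx
      exact le_of_lt hx
    · rw [interior_Ici] at hx
      have hx1 : (1 : ℝ) < x := hx
      refine mul_nonpos_of_nonpos_of_nonneg ?_ (exp_pos _).le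
      rw [div_sub_div _ _ (by positivity) (by positivity)]
      refine div_nonpos_of_nonpos_of_nonneg ?_ (by positivity)
      have : 0 ≤ x * (x * ((besselJ 0 x - besselJ 1 x) ^ 2)) := by positivity
      have h3 : besselJ 0 x * besselJ 1 x * 2 ≤ besselJ 0 x ^ 2 + besselJ 1 x ^ 2 := by
        nlinarith [sq_nonneg (besselJ 0 x - besselJ 1 x)]
      have h4 : -(besselJ 0 x * besselJ 1 x * 2) ≤ besselJ 0 x ^ 2 + besselJ 1 x ^ 2 := by
        nlinarith [sq_nonneg (besselJ 0 x + besselJ 1 x)]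
      have h5 : besselJ 0 x * besselJ 1 x * (x + 1)
          ≤ x * (besselJ 0 x ^ 2 + besselJ 1 x ^ 2) := by nlinarith
      nlinarith
  have hle := hanti (Set.mem_Ici.mpr le_rfl) (Set.mem_Ici.mpr hx) hx
  simp only [hE, inv_one, one_mul] at hle
  have h4 : besselJ 0 x * besselJ 1 x * 2 ≤ besselJ 0 x ^ 2 + besselJ 1 x ^ 2 := by
    nlinarith [sq_nonneg (besselJ 0 x - besselJ 1 x)]
  have h6 : 0 ≤ besselJ 0 x ^ 2 + besselJ 1 x ^ 2 := by positivity
  have h5 : x * (besselJ 0 x ^ 2 + besselJ 1 x ^ 2) / 2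
      ≤ x * (besselJ 0 x ^ 2 + besselJ 1 x ^ 2) - besselJ 0 x * besselJ 1 x := by nlinarith
  have h7 : (1 : ℝ) ≤ rexp (x⁻¹) := one_le_exp (by positivity)
  have h8 : 0 ≤ x * (besselJ 0 x ^ 2 + besselJ 1 x ^ 2) / 2 := by positivity
  nlinarith [le_mul_of_one_le_right (h8.trans h5) h7]

lemma besselJ_sqrt_bound_one_le (n : ℕ) :
    ∃ C : ℝ, ∀ x : ℝ, 1 ≤ x → √x * |besselJ n x| ≤ C ∧ √x * |besselJ (n + 1) x| ≤ C := by
  induction n with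
  | zero =>
    set D := 2 * ((besselJ 0 1 ^ 2 + besselJ 1 1 ^ 2 - besselJ 0 1 * besselJ 1 1) * rexp 1)
    refine ⟨√D, fun x hx => ?_⟩
    have h := besselJ_energy_bound x hx
    have hx0 : 0 ≤ x := by linarith
    constructor <;>
    · rw [← Real.sqrt_sq_eq_abs, ← Real.sqrt_mul hx0]
      refine Real.sqrt_le_sqrt (le_trans ?_ h)
      gcongr
      nlinarith [sq_nonneg (besselJ 0 x), sq_nonneg (besselJ 1 x)]
  | succ n ih =>
    obtain ⟨C, hC⟩ := ih
    refine ⟨2 * (n + 1) * C + C, fun x hx => ?_⟩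
    obtain ⟨h1, h2⟩ := hC x hx
    have hx0 : 0 < x := by linarith
    have hC0 : 0 ≤ C := le_trans (by positivity) h1
    refine ⟨h2.trans (by nlinarith [mul_nonneg (Nat.cast_nonneg (α := ℝ) n) hC0]), ?_⟩
    have hr := besselJ_recurrence n x
    have e : besselJ (n + 2) x = 2 * (n + 1) * (besselJ (n + 1) x / x) - besselJ n x := by
      field_simp; linarith
    have h3 : |besselJ (n + 2) x| ≤ 2 * (n + 1) * |besselJ (n + 1) x| + |besselJ n x| := by
      rw [e]
      refine (abs_sub _ _).trans ?_
      rw [abs_mul, abs_of_nonneg (by positivity : (0:ℝ) ≤ 2 * (n + 1)), abs_div,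
        abs_of_pos hx0]
      gcongr
      exact div_le_self (abs_nonneg _) hx
    calc √x * |besselJ (n + 2) x| ≤ √x * (2 * (n + 1) * |besselJ (n + 1) x| + |besselJ n x|) := by
          gcongr
      _ = 2 * (n + 1) * (√x * |besselJ (n + 1) x|) + √x * |besselJ n x| := by ring
      _ ≤ _ := by gcongr

/-- `|J_n(x)| ≤ C (1 + x)^{-1/2}` on the half-line. -/
lemma exists_besselJ_bound (n : ℕ) :
    ∃ C : ℝ, 0 < C ∧ ∀ x : ℝ, 0 ≤ x → |besselJ n x| ≤ C * (1 + x) ^ (-(1 / 2) : ℝ) := by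
  obtain ⟨C, hC⟩ := besselJ_sqrt_bound_one_le n
  obtain ⟨K, hK⟩ := (isCompact_Icc (a := (0 : ℝ)) (b := 1)).exists_bound_of_continuousOn
    (continuous_besselJ n).continuousOn
  refine ⟨2 * (|C| + |K| + 1), by positivity, fun x hx => ?_⟩
  have hs : (1 + x) ^ (-(1 / 2) : ℝ) = (√(1 + x))⁻¹ := by
    rw [Real.rpow_neg (by positivity), ← Real.sqrt_eq_rpow]
  have hsp : 0 < √(1 + x) := Real.sqrt_pos.mpr (by positivity)
  rw [hs, ← div_eq_mul_inv, le_div_iff₀ hsp]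
  rcases le_total x 1 with h | h
  · have h1 : |besselJ n x| ≤ |K| := (hK x ⟨hx, h⟩).trans (le_abs_self K)
    have h2 : √(1 + x) ≤ 2 := by
      rw [Real.sqrt_le_left (by norm_num)]; linarith
    nlinarith [abs_nonneg (besselJ n x), abs_nonneg C]
  · have h1 : √(1 + x) ≤ 2 * √x := by
      rw [show (2 : ℝ) * √x = √(4 * x) by
        rw [Real.sqrt_mul (by norm_num), show (4 : ℝ) = 2 ^ 2 by norm_num,
          Real.sqrt_sq (by norm_num)]]
      exact Real.sqrt_le_sqrt (by linarith)
    have h2 := (hC x h).1.trans (le_abs_self C)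
    nlinarith [abs_nonneg (besselJ n x), abs_nonneg K]

open Filter Topology in
lemma tendsto_one_add_mul_exp_neg {a : ℝ} (ha : 0 < a) :
    Tendsto (fun x : ℝ => (1 + x) * rexp (-a * x)) atTop (𝓝 0) := by
  have h0 : Tendsto (fun x : ℝ => a * x) atTop atTop := tendsto_id.const_mul_atTop ha
  have h1 := (Real.tendsto_pow_mul_exp_neg_atTop_nhds_zero 0).comp h0
  have h2 := ((Real.tendsto_pow_mul_exp_neg_atTop_nhds_zero 1).comp h0).const_mul a⁻¹
  have h3 := h1.add h2
  simp only [mul_zero, add_zero] at h3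
  refine h3.congr fun x => ?_
  simp only [Function.comp_apply, pow_zero, pow_one, neg_mul]
  field_simp

lemma integrableOn_one_add_mul_exp_neg {a : ℝ} (ha : 0 < a) :
    IntegrableOn (fun x : ℝ => (1 + x) * rexp (-a * x)) (Set.Ioi 0) := by
  have h0 := integrableOn_rpow_mul_exp_neg_mul_rpow (p := 1) (s := 0) (b := a)
    (by norm_num) (by norm_num) ha
  have h1 := integrableOn_rpow_mul_exp_neg_mul_rpow (p := 1) (s := 1) (b := a)
    (by norm_num) (by norm_num) ha
  refine (h0.add h1).congr_fun (fun x _ => ?_) measurableSet_Ioi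
  simp only [Pi.add_apply, rpow_zero, rpow_one]
  ring

/-- The Laplace transform of a real function. -/
noncomputable def realLaplace (f : ℝ → ℝ) (p : ℂ) : ℂ :=
  ∫ x in Set.Ioi (0 : ℝ), Complex.exp (-p * x) * (f x : ℂ)

lemma norm_exp_neg_mul_ofReal (p : ℂ) (x : ℝ) :
    ‖Complex.exp (-p * x)‖ = rexp (-p.re * x) := by
  rw [Complex.norm_exp]; simp

lemma integrableOn_realLaplace {f : ℝ → ℝ} (hf : Continuous f) {C : ℝ}
    (hC : ∀ x, 0 ≤ x → |f x| ≤ C * (1 + x)) {p : ℂ} (hp : 0 < p.re) :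
    IntegrableOn (fun x : ℝ => Complex.exp (-p * x) * (f x : ℂ)) (Set.Ioi 0) := by
  refine Integrable.mono' ((integrableOn_one_add_mul_exp_neg hp).const_mul C) ?_ ?_
  · exact Continuous.aestronglyMeasurable (by fun_prop)
  · refine (ae_restrict_iff' measurableSet_Ioi).mpr (Filter.Eventually.of_forall fun x hx => ?_)
    rw [norm_mul, norm_exp_neg_mul_ofReal, Complex.norm_real, Real.norm_eq_abs]
    have := hC x (le_of_lt hx)
    have he := exp_pos (-p.re * x)
    nlinarith

open Filter Topology in
lemma realLaplace_deriv {f f' : ℝ → ℝ} (hd : ∀ x, HasDerivAt f (f' x) x) (hf' : Continuous f')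
    {C : ℝ} (hC : ∀ x, 0 ≤ x → |f x| ≤ C * (1 + x)) {C' : ℝ}
    (hC' : ∀ x, 0 ≤ x → |f' x| ≤ C' * (1 + x)) {p : ℂ} (hp : 0 < p.re) :
    realLaplace f' p = -(f 0 : ℂ) + p * realLaplace f p := by
  have hf : Continuous f := continuous_iff_continuousAt.mpr fun x => (hd x).continuousAt
  have i1 := integrableOn_realLaplace hf hC hp
  have i2 := integrableOn_realLaplace hf' hC' hp
  have key := integral_Ioi_of_hasDerivAt_of_tendsto' (a := 0) (m := 0)
    (f := fun x : ℝ => Complex.exp (-p * x) * (f x : ℂ))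
    (f' := fun x : ℝ => Complex.exp (-p * x) * (f' x : ℂ) - p * (Complex.exp (-p * x) * (f x : ℂ)))
    (fun x _ => ?_) (i2.sub (i1.const_mul p)) ?_
  · rw [integral_sub i2 (i1.const_mul p), integral_const_mul] at key
    simp only [Complex.ofReal_zero, mul_zero, Complex.exp_zero, one_mul, zero_sub] at key
    unfold realLaplace
    linear_combination key
  · have h1 : HasDerivAt (fun x : ℝ => Complex.exp (-p * x)) (Complex.exp (-p * x) * (-p * 1)) x :=
      ((Complex.ofRealCLM.hasDerivAt (x := x)).const_mul (-p)).cexp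
    refine (h1.mul (hd x).ofReal_comp).congr_deriv ?_
    ring
  · rw [tendsto_zero_iff_norm_tendsto_zero]
    have h2 := (tendsto_one_add_mul_exp_neg hp).const_mul C
    rw [mul_zero] at h2
    refine squeeze_zero' (Eventually.of_forall fun x => norm_nonneg _) ?_ h2
    filter_upwards [eventually_ge_atTop 0] with x hx
    rw [norm_mul, norm_exp_neg_mul_ofReal, Complex.norm_real, Real.norm_eq_abs]
    have := hC x hx
    have he := exp_pos (-p.re * x)
    nlinarith

lemma hasDerivAt_realLaplace {f : ℝ → ℝ} (hf : Continuous f) {C : ℝ}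
    (hC : ∀ x, 0 ≤ x → |f x| ≤ C) {p : ℂ} (hp : 0 < p.re) :
    HasDerivAt (realLaplace f) (-realLaplace (fun x => x * f x) p) p := by
  have hC0 : 0 ≤ C := (abs_nonneg _).trans (hC 0 le_rfl)
  have hC1 : ∀ x, 0 ≤ x → |f x| ≤ C * (1 + x) := fun x hx => (hC x hx).trans (by nlinarith)
  set a := p.re / 2 with ha
  have ha0 : 0 < a := by positivity
  have hs : {q : ℂ | a < q.re} ∈ nhds p :=
    (isOpen_lt continuous_const Complex.continuous_re).mem_nhds (by simp [ha]; linarith)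
  have key := (hasDerivAt_integral_of_dominated_loc_of_deriv_le (𝕜 := ℂ)
    (μ := volume.restrict (Set.Ioi (0 : ℝ)))
    (F := fun q (x : ℝ) => Complex.exp (-q * x) * (f x : ℂ))
    (F' := fun q (x : ℝ) => -(Complex.exp (-q * x) * ((x * f x : ℝ) : ℂ)))
    (bound := fun x => C * ((1 + x) * rexp (-a * x))) hs ?_
    (integrableOn_realLaplace hf hC1 hp) ?_ ?_ ?_ ?_).2
  · rw [integral_neg] at key
    exact key
  · exact Filter.Eventually.of_forall fun q => Continuous.aestronglyMeasurable (by fun_prop)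
  · exact Continuous.aestronglyMeasurable (by fun_prop)
  · refine (ae_restrict_iff' measurableSet_Ioi).mpr
      (Filter.Eventually.of_forall fun x hx q hq => ?_)
    have hx0 : (0 : ℝ) < x := hx
    have hq' : a < q.re := hq
    rw [norm_neg, norm_mul, norm_exp_neg_mul_ofReal, Complex.norm_real, Real.norm_eq_abs, abs_mul,
      abs_of_pos hx0]
    have h1 : rexp (-q.re * x) ≤ rexp (-a * x) := exp_le_exp.mpr (by nlinarith)
    have h2 : x * |f x| ≤ C * (1 + x) := by nlinarith [hC x hx0.le]
    calc rexp (-q.re * x) * (x * |f x|) ≤ rexp (-a * x) * (C * (1 + x)) := by gcongr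
      _ = _ := by ring
  · exact (integrableOn_one_add_mul_exp_neg ha0).const_mul C
  · refine Filter.Eventually.of_forall fun x q _ => ?_
    have h1 : HasDerivAt (fun q : ℂ => Complex.exp (-q * x)) (Complex.exp (-q * x) * (-1 * x)) q :=
      (((hasDerivAt_id q).neg).mul_const (x : ℂ)).cexp
    refine (h1.mul_const (f x : ℂ)).congr_deriv ?_
    push_cast; ring

lemma exists_besselJ_bound_const (n : ℕ) :
    ∃ C : ℝ, 0 < C ∧ ∀ x : ℝ, 0 ≤ x → |besselJ n x| ≤ C := by
  obtain ⟨C, hC, h⟩ := exists_besselJ_bound n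
  refine ⟨C, hC, fun x hx => (h x hx).trans ?_⟩
  have : (1 + x) ^ (-(1 / 2) : ℝ) ≤ 1 :=
    Real.rpow_le_one_of_one_le_of_nonpos (by linarith) (by norm_num)
  nlinarith

lemma exists_besselJ_bound_linear (n : ℕ) :
    ∃ C : ℝ, 0 < C ∧ ∀ x : ℝ, 0 ≤ x → |besselJ n x| ≤ C * (1 + x) := by
  obtain ⟨C, hC, h⟩ := exists_besselJ_bound_const n
  exact ⟨C, hC, fun x hx => (h x hx).trans (by nlinarith)⟩

lemma realLaplace_besselJ_one {p : ℂ} (hp : 0 < p.re) :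
    realLaplace (besselJ 1) p = 1 - p * realLaplace (besselJ 0) p := by
  obtain ⟨C0, _, h0⟩ := exists_besselJ_bound_linear 0
  obtain ⟨C1, _, h1⟩ := exists_besselJ_bound_linear 1
  have := realLaplace_deriv hasDerivAt_besselJ_zero (continuous_besselJ 1).neg h0
    (C' := C1) (fun x hx => by rw [abs_neg]; exact h1 x hx) hp
  have e : realLaplace (fun x => -besselJ 1 x) p = -realLaplace (besselJ 1) p := by
    simp [realLaplace, integral_neg]
  rw [e, besselJ_zero_zero] at this
  push_cast at this
  linear_combination -this

lemma realLaplace_besselJ_add_two (n : ℕ) {p : ℂ} (hp : 0 < p.re) :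
    realLaplace (besselJ (n + 2)) p
      = realLaplace (besselJ n) p - 2 * p * realLaplace (besselJ (n + 1)) p := by
  obtain ⟨C0, _, h0⟩ := exists_besselJ_bound_linear n
  obtain ⟨C1, _, h1⟩ := exists_besselJ_bound_linear (n + 1)
  obtain ⟨C2, _, h2⟩ := exists_besselJ_bound_linear (n + 2)
  have hc0 := continuous_besselJ n
  have hc2 := continuous_besselJ (n + 2)
  have := realLaplace_deriv (hasDerivAt_besselJ_succ n) (by fun_prop) h1
    (C' := C0 + C2) (fun x hx => by
      rw [abs_div, abs_two]
      have := abs_sub (besselJ n x) (besselJ (n + 2) x)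
      have := h0 x hx
      have := h2 x hx
      have := abs_nonneg (besselJ n x - besselJ (n + 2) x)
      linarith) hp
  have e : realLaplace (fun x => (besselJ n x - besselJ (n + 2) x) / 2) p
      = (realLaplace (besselJ n) p - realLaplace (besselJ (n + 2)) p) / 2 := by
    unfold realLaplace
    rw [← integral_sub (integrableOn_realLaplace hc0 h0 hp) (integrableOn_realLaplace hc2 h2 hp),
      ← integral_div]
    congr 1; ext x; push_cast; ring
  rw [e, besselJ_succ_zero] at this
  push_cast at this
  linear_combination -2 * this

lemma one_add_sq_mem_slitPlane {p : ℂ} (hp : 0 < p.re ∨ |p.im| < 1) :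
    1 + p ^ 2 ∈ Complex.slitPlane := by
  rw [Complex.mem_slitPlane_iff]
  have h1 : (1 + p ^ 2).re = 1 + p.re ^ 2 - p.im ^ 2 := by simp [pow_two]; ring
  have h2 : (1 + p ^ 2).im = 2 * p.re * p.im := by simp [pow_two]; ring
  rw [h1, h2]
  by_cases h : |p.im| < 1
  · left
    have := (sq_lt_one_iff_abs_lt_one _).mpr h
    nlinarith [sq_nonneg p.re]
  · right
    have h0 : 0 < p.re := hp.resolve_right h
    have : p.im ≠ 0 := fun h0 => h (by simp [h0])
    positivity

/-- The Laplace transform of `J₀` satisfies `(1 + p²) L' + p L = 0`. -/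
lemma hasDerivAt_realLaplace_besselJ_zero {p : ℂ} (hp : 0 < p.re) :
    HasDerivAt (realLaplace (besselJ 0)) (-(p / (1 + p ^ 2)) * realLaplace (besselJ 0) p) p := by
  obtain ⟨C0, hC0, h0⟩ := exists_besselJ_bound_const 0
  obtain ⟨C1, hC1, h1⟩ := exists_besselJ_bound_const 1
  have hd0 := hasDerivAt_realLaplace (continuous_besselJ 0) h0 hp
  have hd1 := hasDerivAt_realLaplace (continuous_besselJ 1) h1 hp
  have hc0 := continuous_besselJ 0
  have hxJ : ∀ x : ℝ, HasDerivAt (fun x => x * besselJ 1 x) (x * besselJ 0 x) x := by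
    intro x
    have hr := besselJ_recurrence 0 x
    refine ((hasDerivAt_id x).mul (hasDerivAt_besselJ_succ 0 x)).congr_deriv ?_
    simp only [zero_add, Nat.cast_zero, id] at hr ⊢
    linarith
  have e1 := realLaplace_deriv hxJ (by fun_prop) (C := C1) (C' := C0)
    (fun x hx => by
      rw [abs_mul, abs_of_nonneg hx]; nlinarith [h1 x hx])
    (fun x hx => by
      rw [abs_mul, abs_of_nonneg hx]; nlinarith [h0 x hx]) hp
  have hev : realLaplace (besselJ 1) =ᶠ[nhds p] fun p => 1 - p * realLaplace (besselJ 0) p := by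
    filter_upwards [(isOpen_lt continuous_const Complex.continuous_re).mem_nhds hp] with q hq
    exact realLaplace_besselJ_one hq
  have e2 := hd1.unique
    ((((hasDerivAt_id p).mul hd0).const_sub 1).congr_of_eventuallyEq hev)
  have hne : 1 + p ^ 2 ≠ 0 :=
    Complex.slitPlane_ne_zero (one_add_sq_mem_slitPlane (Or.inl hp))
  refine hd0.congr_deriv ?_
  simp only [zero_mul, Complex.ofReal_zero, neg_zero, zero_add, id] at e1 e2
  field_simp
  linear_combination -e1 + p * e2

lemma norm_realLaplace_besselJ_le (n : ℕ) :
    ∃ C : ℝ, ∀ p : ℝ, 0 < p → ‖realLaplace (besselJ n) p‖ ≤ C / p := by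
  obtain ⟨C, hC, h⟩ := exists_besselJ_bound_const n
  refine ⟨C, fun p hp => ?_⟩
  have hi : IntegrableOn (fun x : ℝ => C * rexp (-p * x)) (Set.Ioi 0) :=
    (integrableOn_exp_mul_Ioi (by linarith) 0).const_mul C
  refine (norm_integral_le_of_norm_le hi ?_).trans (le_of_eq ?_)
  · refine (ae_restrict_iff' measurableSet_Ioi).mpr (Filter.Eventually.of_forall fun x hx => ?_)
    rw [norm_mul, norm_exp_neg_mul_ofReal, Complex.norm_real, Real.norm_eq_abs, mul_comm]
    simp only [Complex.ofReal_re]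
    gcongr
    exact h x (le_of_lt hx)
  · rw [integral_const_mul, integral_exp_mul_Ioi (by linarith)]
    simp [div_eq_mul_inv]

open Filter Topology in
lemma realLaplace_besselJ_zero {p : ℂ} (hp : 0 < p.re) :
    realLaplace (besselJ 0) p = (1 + p ^ 2) ^ (-(1 / 2) : ℂ) := by
  set U : Set ℂ := {q | 0 < q.re} with hU
  have hUo : IsOpen U := isOpen_lt continuous_const Complex.continuous_re
  have hUc : IsPreconnected U := (convex_halfSpace_re_gt 0).isPreconnected
  set W : ℂ → ℂ := fun q => realLaplace (besselJ 0) q * (1 + q ^ 2) ^ (1 / 2 : ℂ) with hW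
  have hne : ∀ q ∈ U, 1 + q ^ 2 ≠ 0 := fun q hq =>
    Complex.slitPlane_ne_zero (one_add_sq_mem_slitPlane (Or.inl hq))
  have hd : ∀ q ∈ U, HasDerivAt W 0 q := by
    intro q hq
    have h1 := hasDerivAt_realLaplace_besselJ_zero hq
    have h2 : HasDerivAt (fun q : ℂ => 1 + q ^ 2) (2 * q) q :=
      ((hasDerivAt_pow 2 q).const_add 1).congr_deriv (by norm_num)
    have h3 := h2.cpow_const (c := (1 / 2 : ℂ))
      (one_add_sq_mem_slitPlane (Or.inl hq))
    refine (h1.mul h3).congr_deriv ?_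
    have := hne q hq
    rw [Complex.cpow_sub _ _ this, Complex.cpow_one]
    field_simp
    ring
  have hconst : ∀ q ∈ U, ∀ q' ∈ U, W q = W q' := fun q hq q' hq' =>
    hUo.is_const_of_deriv_eq_zero hUc
      (fun z hz => (hd z hz).differentiableAt.differentiableWithinAt)
      (fun z hz => (hd z hz).deriv) hq hq'
  obtain ⟨C, hC⟩ := norm_realLaplace_besselJ_le 1
  have hlim1 : Tendsto (fun t : ℝ => (t : ℂ) * realLaplace (besselJ 0) t) atTop (𝓝 1) := by
    have h0 : Tendsto (fun t : ℝ => realLaplace (besselJ 1) t) atTop (𝓝 0) := by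
      refine squeeze_zero_norm' (a := fun t => C / t) ?_ (tendsto_id.const_div_atTop C)
      filter_upwards [eventually_gt_atTop 0] with t ht
      exact hC t ht
    have h1 : Tendsto (fun t : ℝ => 1 - realLaplace (besselJ 1) t) atTop (𝓝 1) := by
      simpa using h0.const_sub 1
    refine h1.congr' ?_
    filter_upwards [eventually_gt_atTop 0] with t ht
    rw [realLaplace_besselJ_one (by simpa using ht)]
    ring
  have hlim2 : Tendsto (fun t : ℝ => ((√(1 + t⁻¹ ^ 2) : ℝ) : ℂ)) atTop (𝓝 1) := by
    have h : Tendsto (fun t : ℝ => √(1 + t⁻¹ ^ 2)) atTop (𝓝 (√(1 + 0 ^ 2))) :=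
      (Real.continuous_sqrt.tendsto _).comp ((tendsto_inv_atTop_zero.pow 2).const_add 1)
    have h2 := (Complex.continuous_ofReal.tendsto _).comp h
    simpa [Function.comp_def] using h2
  have hWlim : Tendsto (fun t : ℝ => W t) atTop (𝓝 1) := by
    have := hlim1.mul hlim2
    rw [one_mul] at this
    refine this.congr' ?_
    filter_upwards [eventually_gt_atTop 0] with t ht
    have e : ((1 : ℂ) + (t : ℂ) ^ 2) ^ (1 / 2 : ℂ) = ((t * √(1 + t⁻¹ ^ 2) : ℝ) : ℂ) := by
      have h1 : t * √(1 + t⁻¹ ^ 2) = (1 + t ^ 2) ^ (1 / 2 : ℝ) := by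
        rw [← Real.sqrt_eq_rpow]
        nth_rewrite 1 [← Real.sqrt_sq ht.le]
        rw [← Real.sqrt_mul (by positivity)]
        congr 1; field_simp
        ring
      rw [h1, Complex.ofReal_cpow (by positivity)]
      push_cast; rfl
    simp only [hW]
    rw [e]; push_cast; ring
  have hWp : W p = 1 := by
    refine tendsto_nhds_unique (tendsto_const_nhds (x := W p) (f := (atTop : Filter ℝ))) ?_
    refine hWlim.congr' ?_
    filter_upwards [eventually_gt_atTop 0] with t ht
    exact hconst _ (by simpa [hU] using ht) _ hp
  rw [Complex.cpow_neg]
  exact eq_inv_of_mul_eq_one_left hWp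

open Filter Topology in
/-- Shifting the contour to `+i∞` for an entire function decaying in the upper half-plane. -/
lemma integral_eq_zero_of_upper_half_plane_decay {Φ : ℂ → ℂ} (hΦ : Differentiable ℂ Φ) {C c : ℝ}
    (hc : 0 < c)
    (hb : ∀ x y : ℝ, 0 ≤ y → ‖Φ (x + y * Complex.I)‖ ≤ C * rexp (-c * y) / (1 + x ^ 2)) :
    ∫ x : ℝ, Φ x = 0 := by
  have hb0 : ∀ x : ℝ, ‖Φ x‖ ≤ C * (1 + x ^ 2)⁻¹ := by
    intro x
    simpa [div_eq_mul_inv] using hb x 0 le_rfl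
  have hC : 0 ≤ C := by simpa using (norm_nonneg _).trans (hb0 0)
  have hint : Integrable fun x : ℝ => Φ x :=
    Integrable.mono' (integrable_inv_one_add_sq.const_mul C)
      (hΦ.continuous.comp Complex.continuous_ofReal).aestronglyMeasurable
      (Eventually.of_forall hb0)
  have h1 := intervalIntegral_tendsto_integral hint tendsto_neg_atTop_atBot tendsto_id
  refine tendsto_nhds_unique h1 ?_
  have hlim : Tendsto (fun T : ℝ => 2 * C * ((1 + T) * rexp (-c * T)) + 2 * C * T⁻¹) atTop
      (𝓝 0) := by
    simpa using ((tendsto_one_add_mul_exp_neg hc).const_mul (2 * C)).add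
      (tendsto_inv_atTop_zero.const_mul (2 * C))
  refine squeeze_zero_norm' ?_ hlim
  filter_upwards [eventually_gt_atTop 0] with T hT
  have hrect := Complex.integral_boundary_rect_eq_zero_of_differentiableOn Φ (-T : ℝ)
    (T + T * Complex.I) hΦ.differentiableOn
  simp only [Complex.ofReal_re, Complex.ofReal_im, Complex.ofReal_zero, zero_mul, add_zero,
    Complex.add_re, Complex.mul_re, Complex.I_re, mul_zero, Complex.I_im, mul_one, sub_self,
    Complex.add_im, Complex.mul_im, zero_add, smul_eq_mul] at hrect
  have htop : ‖∫ x in (-T)..T, Φ (x + T * Complex.I)‖ ≤ C * rexp (-c * T) * |T - -T| := by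
    refine intervalIntegral.norm_integral_le_of_norm_le_const fun x _ => ?_
    refine (hb x T hT.le).trans (div_le_self (by positivity) ?_)
    nlinarith [sq_nonneg x]
  have hside : ∀ S : ℝ, S ^ 2 = T ^ 2 →
      ‖∫ y in (0 : ℝ)..T, Φ (S + y * Complex.I)‖ ≤ C / (T ^ 2) * |T - 0| := by
    intro S hS
    refine intervalIntegral.norm_integral_le_of_norm_le_const fun y hy => ?_
    rw [Set.uIoc_of_le hT.le] at hy
    refine (hb S y hy.1.le).trans ?_
    rw [hS]
    have : rexp (-c * y) ≤ 1 := exp_le_one_iff.mpr (by nlinarith [hy.1])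
    have h2 : C * rexp (-c * y) ≤ C := by nlinarith
    gcongr
    linarith
  have hs1 := hside T rfl
  have hs2 := hside (-T) (by ring)
  have e : (∫ x in (-T)..(id T), Φ x) = (∫ x in (-T)..T, Φ (x + T * Complex.I))
      - Complex.I * (∫ y in (0 : ℝ)..T, Φ (T + y * Complex.I))
      + Complex.I * (∫ y in (0 : ℝ)..T, Φ ((-T : ℝ) + y * Complex.I)) := by
    simp only [id]
    linear_combination hrect
  rw [e]
  refine (norm_add_le _ _).trans ((add_le_add_left (norm_sub_le _ _) _).trans ?_)
  rw [norm_mul, norm_mul, Complex.norm_I, one_mul, one_mul]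
  rw [sub_neg_eq_add, abs_of_pos (by linarith)] at htop
  rw [sub_zero, abs_of_pos hT, show C / T ^ 2 * T = C * T⁻¹ by field_simp] at hs1 hs2
  have he := exp_pos (-c * T)
  nlinarith [mul_nonneg hC he.le]

/-- Entire functions of exponential type `τ` with quadratic decay along horizontal lines. -/
def PaleyWienerBound (τ : ℝ) (H : ℂ → ℂ) : Prop :=
  Differentiable ℂ H ∧ ∃ C : ℝ, ∀ z : ℂ, ‖H z‖ ≤ C * rexp (τ * |z.im|) / (1 + ‖z‖ ^ 2)

lemma PaleyWienerBound.norm_add_mul_I_le {τ : ℝ} {H : ℂ → ℂ} {C : ℝ}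
    (h : ∀ z : ℂ, ‖H z‖ ≤ C * rexp (τ * |z.im|) / (1 + ‖z‖ ^ 2)) (x y : ℝ) :
    ‖H (x + y * Complex.I)‖ ≤ C * rexp (τ * |y|) / (1 + x ^ 2) := by
  have hC : 0 ≤ C := by simpa using (norm_nonneg _).trans (h 0)
  refine (h _).trans ?_
  have e : ‖(x : ℂ) + y * Complex.I‖ ^ 2 = x ^ 2 + y ^ 2 := by
    rw [Complex.sq_norm, Complex.normSq_add_mul_I]
  rw [e]
  simp only [Complex.add_im, Complex.ofReal_im, Complex.mul_im, Complex.ofReal_re, Complex.I_im,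
    mul_one, Complex.I_re, mul_zero, add_zero, zero_add]
  gcongr
  nlinarith [sq_nonneg y]

lemma PaleyWienerBound.integrable {τ : ℝ} {H : ℂ → ℂ} (h : PaleyWienerBound τ H) :
    Integrable fun x : ℝ => H x := by
  obtain ⟨hd, C, hC⟩ := h
  refine Integrable.mono' (integrable_inv_one_add_sq.const_mul C)
    (hd.continuous.comp Complex.continuous_ofReal).aestronglyMeasurable
    (Filter.Eventually.of_forall fun x => ?_)
  simpa [div_eq_mul_inv] using PaleyWienerBound.norm_add_mul_I_le hC x 0

open FourierTransform in
lemma fourier_neg_of_even {f : ℝ → ℂ} (hf : ∀ x, f (-x) = f x) (ξ : ℝ) : 𝓕 f (-ξ) = 𝓕 f ξ := by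
  rw [Real.fourier_real_eq_integral_exp_smul, Real.fourier_real_eq_integral_exp_smul,
    ← integral_neg_eq_self]
  congr 1; ext x
  rw [hf]
  congr 4; ring

open FourierTransform in
lemma PaleyWienerBound.fourier_eq_zero {τ : ℝ} {H : ℂ → ℂ} (h : PaleyWienerBound τ H)
    (heven : ∀ z, H (-z) = H z) {ξ : ℝ} (hξ : τ < 2 * π * |ξ|) :
    𝓕 (fun x : ℝ => H x) ξ = 0 := by
  obtain ⟨hd, C, hC⟩ := h
  wlog hneg : ξ ≤ 0 generalizing ξ with hw
  · rw [← fourier_neg_of_even (fun x => by rw [Complex.ofReal_neg, heven])]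
    exact hw (by rwa [abs_neg]) (by linarith)
  rw [abs_of_nonpos hneg] at hξ
  rw [Real.fourier_real_eq_integral_exp_smul]
  have key := integral_eq_zero_of_upper_half_plane_decay
    (Φ := fun z => Complex.exp (((-2 * π * ξ : ℝ) : ℂ) * z * Complex.I) * H z)
    (by fun_prop) (C := C) (c := -2 * π * ξ - τ) (by linarith) (fun x y hy => ?_)
  · rw [← key]
    congr 1; ext x
    rw [smul_eq_mul]
    congr 2; push_cast; ring
  · rw [norm_mul, Complex.norm_exp]
    have h1 := PaleyWienerBound.norm_add_mul_I_le hC x y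
    have h2 : (((-2 * π * ξ : ℝ) : ℂ) * ((x : ℂ) + y * Complex.I) * Complex.I).re
        = 2 * π * ξ * y := by
      simp
    rw [h2]
    refine (mul_le_mul_of_nonneg_left h1 (exp_pos _).le).trans (le_of_eq ?_)
    rw [abs_of_nonneg hy, show -(-2 * π * ξ - τ) * y = 2 * π * ξ * y + τ * y by ring, Real.exp_add]
    ring

open FourierTransform in
/-- Spectral representation of an even Paley–Wiener function, with its even moments. -/
lemma PaleyWienerBound.exists_spectral {τ : ℝ} {H : ℂ → ℂ} (h : PaleyWienerBound τ H)
    (heven : ∀ z, H (-z) = H z) :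
    ∃ φ : ℝ → ℂ, Continuous φ ∧ HasCompactSupport φ ∧ (∀ ξ, φ (-ξ) = φ ξ) ∧
      (∀ ξ, τ < 2 * π * |ξ| → φ ξ = 0) ∧
      (∀ x : ℝ, H x = ∫ ξ : ℝ, Complex.exp (-(2 * π * ξ * Complex.I) * x) * φ ξ) ∧
      ∀ j : ℕ, iteratedDeriv (2 * j) (fun x : ℝ => H x) 0
        = ∫ ξ : ℝ, (2 * π * ξ * Complex.I) ^ (2 * j) * φ ξ := by
  have hint := h.integrable
  have hfc : Continuous fun x : ℝ => H x := h.1.continuous.comp Complex.continuous_ofReal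
  have hev : ∀ x : ℝ, H ((-x : ℝ) : ℂ) = H x := fun x => by rw [Complex.ofReal_neg, heven]
  set φ := 𝓕 (fun x : ℝ => H x) with hφ
  have hzero : ∀ ξ, τ < 2 * π * |ξ| → φ ξ = 0 := fun ξ hξ => h.fourier_eq_zero heven hξ
  have hcont : Continuous φ :=
    VectorFourier.fourierIntegral_continuous Real.continuous_fourierChar
      (by exact continuous_inner) hint
  have hsupp : HasCompactSupport φ := by
    refine HasCompactSupport.intro (isCompact_Icc (a := -(τ / (2 * π))) (b := τ / (2 * π)))
      fun ξ hξ => hzero ξ ?_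
    by_contra hle
    refine hξ (abs_le.mp ?_)
    rw [le_div_iff₀ (by positivity)]
    linarith
  have hinv : 𝓕 φ = fun x : ℝ => H x := by
    have h1 := hfc.fourierInv_fourier_eq hint (hcont.integrable_of_hasCompactSupport hsupp)
    ext x
    have h2 := congrFun h1 (-x)
    rw [Real.fourierInv_eq_fourier_neg, neg_neg] at h2
    rw [h2, hev]
  refine ⟨φ, hcont, hsupp, fun ξ => fourier_neg_of_even hev ξ, hzero, fun x => ?_, fun j => ?_⟩
  · have h1 := congrFun hinv x
    rw [← h1, Real.fourier_real_eq_integral_exp_smul]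
    congr 1; ext ξ
    rw [smul_eq_mul]
    congr 2; push_cast; ring
  · rw [← hinv, Real.iteratedDeriv_fourier (N := ⊤) (fun n _ => ?_) le_top,
      Real.fourier_real_eq_integral_exp_smul]
    · congr 1; ext ξ
      simp only [mul_zero, Complex.ofReal_zero, zero_mul, Complex.exp_zero, one_mul, smul_eq_mul]
      rw [show (-2 * (π : ℂ) * Complex.I * ξ) = -(2 * π * ξ * Complex.I) by ring,
        Even.neg_pow ⟨j, by ring⟩]
    · refine Continuous.integrable_of_hasCompactSupport (by fun_prop) ?_
      exact hsupp.smul_left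

/-- The solution of `u (n + 2) = u n - 2 p u (n + 1)` with initial values `u 0 = a`, `u 1 = b`. -/
def besselRec (a b p : ℂ) : ℕ → ℂ
  | 0 => a
  | 1 => b
  | n + 2 => besselRec a b p n - 2 * p * besselRec a b p (n + 1)

lemma continuous_besselRec {a b : ℂ → ℂ} (ha : Continuous a) (hb : Continuous b) (n : ℕ) :
    Continuous fun p => besselRec (a p) (b p) p n := by
  induction n using Nat.twoStepInduction with
  | zero => exact ha
  | one => exact hb
  | more n h0 h1 =>
    simp only [besselRec]
    exact h0.sub ((continuous_const.mul continuous_id).mul h1)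

lemma besselRec_neg (p : ℂ) (n : ℕ) :
    besselRec 1 p (-p) n = (-1) ^ n * besselRec 1 (-p) p n := by
  induction n using Nat.twoStepInduction with
  | zero => simp [besselRec]
  | one => simp [besselRec]
  | more n h0 h1 => simp only [besselRec, h0, h1]; ring

lemma realLaplace_besselJ_eq_besselRec (n : ℕ) {p : ℂ} (hp : 0 < p.re) :
    realLaplace (besselJ n) p
      = (1 + p ^ 2) ^ (-(1 / 2) : ℂ) * besselRec 1 (-p) p n + besselRec 0 1 p n := by
  induction n using Nat.twoStepInduction with
  | zero => simp [besselRec, realLaplace_besselJ_zero hp]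
  | one => simp only [besselRec, realLaplace_besselJ_one hp, realLaplace_besselJ_zero hp]; ring
  | more n h0 h1 => rw [realLaplace_besselJ_add_two n hp, h0, h1]; simp only [besselRec]; ring

lemma besselRec_zero_one_eq (p : ℂ) (l : ℕ) :
    besselRec 0 1 p (2 * l + 1)
        = ∑ j ∈ Finset.range (l + 1), ((l + j).choose (2 * j) : ℂ) * (2 * p) ^ (2 * j) ∧
      besselRec 0 1 p (2 * l + 2)
        = -∑ j ∈ Finset.range (l + 1),
            ((l + 1 + j).choose (2 * j + 1) : ℂ) * (2 * p) ^ (2 * j + 1) := by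
  induction l with
  | zero => simp [besselRec]
  | succ l ih =>
    obtain ⟨h1, h2⟩ := ih
    have h3 : besselRec 0 1 p (2 * (l + 1) + 1) = ∑ j ∈ Finset.range (l + 1 + 1),
        ((l + 1 + j).choose (2 * j) : ℂ) * (2 * p) ^ (2 * j) := by
      have e : besselRec 0 1 p (2 * (l + 1) + 1)
          = besselRec 0 1 p (2 * l + 1) - 2 * p * besselRec 0 1 p (2 * l + 2) := rfl
      have ext0 : besselRec 0 1 p (2 * l + 1)
          = ∑ j ∈ Finset.range (l + 1 + 1), ((l + j).choose (2 * j) : ℂ) * (2 * p) ^ (2 * j) := by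
        rw [Finset.sum_range_succ, ← h1, Nat.choose_eq_zero_of_lt (by lia)]
        simp
      rw [e, ext0, h2, Finset.sum_range_succ', Finset.sum_range_succ' _ (l + 1), mul_neg,
        sub_neg_eq_add, Finset.mul_sum, add_right_comm, ← Finset.sum_add_distrib]
      congr 1
      · refine Finset.sum_congr rfl fun j _ => ?_
        rw [show l + 1 + (j + 1) = (l + (j + 1)) + 1 by ring,
          show 2 * (j + 1) = (2 * j + 1) + 1 by ring, Nat.choose_succ_succ,
          show l + 1 + j = l + (j + 1) by ring]
        push_cast; ring
      · simp
    refine ⟨h3, ?_⟩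
    have e : besselRec 0 1 p (2 * (l + 1) + 2)
        = besselRec 0 1 p (2 * l + 2) - 2 * p * besselRec 0 1 p (2 * (l + 1) + 1) := rfl
    have ext0 : besselRec 0 1 p (2 * l + 2) = -∑ j ∈ Finset.range (l + 1 + 1),
        ((l + 1 + j).choose (2 * j + 1) : ℂ) * (2 * p) ^ (2 * j + 1) := by
      rw [Finset.sum_range_succ, neg_add, ← h2, Nat.choose_eq_zero_of_lt (by lia)]
      simp
    rw [e, ext0, h3, Finset.mul_sum, ← neg_add', ← Finset.sum_add_distrib]
    congr 1
    refine Finset.sum_congr rfl fun j _ => ?_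
    rw [show l + 1 + 1 + j = (l + 1 + j) + 1 by ring, Nat.choose_succ_succ]
    push_cast; ring

/-- The damped Bessel transform of a Fourier integral, computed by Fubini. -/
lemma integral_exp_neg_mul_besselJ_mul {φ : ℝ → ℂ} (hφi : Integrable φ) {H : ℂ → ℂ}
    (hφH : ∀ x : ℝ, H x = ∫ ξ : ℝ, Complex.exp (-(2 * π * ξ * Complex.I) * x) * φ ξ)
    (n : ℕ) {ε : ℝ} (hε : 0 < ε) :
    ∫ x in Set.Ioi (0 : ℝ), Complex.exp (-ε * x) * (besselJ n x : ℂ) * H x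
      = ∫ ξ : ℝ, realLaplace (besselJ n) (ε + 2 * π * ξ * Complex.I) * φ ξ := by
  have hJc := continuous_besselJ n
  obtain ⟨D, hD0, hD⟩ := exists_besselJ_bound_linear n
  have hI : IntegrableOn (fun x : ℝ => Complex.exp (-ε * x) * (besselJ n x : ℂ)) (Set.Ioi 0) :=
    integrableOn_realLaplace hJc hD (p := ε) (by simpa using hε)
  have hsw := integral_integral_swap (μ := volume.restrict (Set.Ioi (0 : ℝ))) (ν := volume)
    (f := fun x ξ : ℝ => Complex.exp (-(2 * π * ξ * Complex.I) * x) *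
      (Complex.exp (-ε * x) * (besselJ n x : ℂ) * φ ξ)) ?_
  · calc _ = ∫ x in Set.Ioi (0 : ℝ), ∫ ξ : ℝ, Complex.exp (-(2 * π * ξ * Complex.I) * x) *
          (Complex.exp (-ε * x) * (besselJ n x : ℂ) * φ ξ) := by
          congr 1; ext x
          rw [hφH x, ← integral_const_mul]
          congr 1; ext ξ; ring
      _ = _ := hsw
      _ = _ := by
          congr 1; ext ξ
          rw [realLaplace, ← integral_mul_const]
          congr 1; ext x
          rw [show -(ε + 2 * π * ξ * Complex.I) * (x : ℂ)
            = -(2 * π * ξ * Complex.I) * x + -ε * x by ring, Complex.exp_add]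
          ring
  · refine Integrable.bdd_mul (c := 1) (Integrable.mul_prod hI hφi) ?_ ?_
    · refine Continuous.aestronglyMeasurable ?_
      fun_prop
    · refine Filter.Eventually.of_forall fun q => ?_
      rw [Complex.norm_exp]
      simp

lemma tendsto_integral_exp_neg_mul_besselJ_mul {H : ℂ → ℂ} (hHc : Continuous fun x : ℝ => H x)
    (hH : Integrable fun x : ℝ => H x) (n : ℕ) :
    Filter.Tendsto (fun ε : ℝ =>
      ∫ x in Set.Ioi (0 : ℝ), Complex.exp (-ε * x) * (besselJ n x : ℂ) * H x)
      (nhdsWithin 0 (Set.Ioi 0)) (nhds (∫ x in Set.Ioi (0 : ℝ), (besselJ n x : ℂ) * H x)) := by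
  have hJc := continuous_besselJ n
  obtain ⟨C, hC0, hC⟩ := exists_besselJ_bound_const n
  refine tendsto_integral_filter_of_dominated_convergence (fun x => C * ‖H x‖) ?_ ?_
    (hH.norm.const_mul C).integrableOn ?_
  · refine Filter.Eventually.of_forall fun ε => Continuous.aestronglyMeasurable ?_
    exact (Continuous.mul (by fun_prop) (by fun_prop)).mul hHc
  · filter_upwards [self_mem_nhdsWithin] with ε hε
    refine (ae_restrict_iff' measurableSet_Ioi).mpr (Filter.Eventually.of_forall fun x hx => ?_)
    have hε : 0 < ε := hε
    have hx : 0 < x := hx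
    rw [norm_mul, norm_mul, Complex.norm_exp, Complex.norm_real]
    gcongr
    calc _ ≤ 1 * C := by
          gcongr
          · rw [Real.exp_le_one_iff]; simp; positivity
          · exact hC x hx.le
      _ = C := one_mul _
  · refine Filter.Eventually.of_forall fun x => ?_
    have : Continuous fun ε : ℝ => Complex.exp (-ε * x) * (besselJ n x : ℂ) * H x := by fun_prop
    have h0 := this.tendsto 0
    simp only [Complex.ofReal_zero, neg_zero, zero_mul, Complex.exp_zero, one_mul] at h0
    exact h0.mono_left nhdsWithin_le_nhds

/-- Hankel transform of odd order of an even Paley–Wiener function of type less than one. -/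
lemma PaleyWienerBound.integral_mul_besselJ {τ : ℝ} {H : ℂ → ℂ} (h : PaleyWienerBound τ H)
    (heven : ∀ z, H (-z) = H z) (hτ : τ < 1) (l : ℕ) :
    ∫ x in Set.Ioi (0 : ℝ), (besselJ (2 * l + 1) x : ℂ) * H x
      = ∑ j ∈ Finset.range (l + 1), ((l + j).choose (2 * j) : ℂ) * 2 ^ (2 * j)
          * iteratedDeriv (2 * j) (fun x : ℝ => H x) 0 := by
  obtain ⟨φ, hφc, hφs, hφe, hφ0, hφH, hφm⟩ := h.exists_spectral heven
  have hφi : Integrable φ := hφc.integrable_of_hasCompactSupport hφs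
  obtain ⟨n, hn⟩ : ∃ n, n = 2 * l + 1 := ⟨_, rfl⟩
  rw [← hn]
  obtain ⟨W, hW⟩ : ∃ W : ℂ → ℂ, ∀ p, W p = (1 + p ^ 2) ^ (-(1 / 2) : ℂ) * besselRec 1 (-p) p n
    + besselRec 0 1 p n := ⟨_, fun _ => rfl⟩
  have hA : Continuous fun p : ℂ => besselRec 1 (-p) p n :=
    continuous_besselRec continuous_const continuous_neg n
  have hB : Continuous fun p : ℂ => besselRec 0 1 p n :=
    continuous_besselRec continuous_const continuous_const n
  have hWc : ∀ p : ℂ, |p.im| < 1 → ContinuousAt W p := fun p hp => by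
    rw [funext hW]
    have h1 : ContinuousAt (fun x : ℂ => (1 + x ^ 2) ^ (-(1 / 2) : ℂ)) p :=
      ContinuousAt.cpow (f := fun x : ℂ => 1 + x ^ 2) (by fun_prop) continuousAt_const
        (one_add_sq_mem_slitPlane (Or.inr hp))
    exact (h1.mul hA.continuousAt).add hB.continuousAt
  have him : ∀ ε ξ : ℝ, ((ε : ℂ) + 2 * π * ξ * Complex.I).im = 2 * π * ξ := fun ε ξ => by simp
  have hre : ∀ ε ξ : ℝ, ((ε : ℂ) + 2 * π * ξ * Complex.I).re = ε := fun ε ξ => by simp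
  have habs : ∀ ξ : ℝ, |2 * π * ξ| = 2 * π * |ξ| := fun ξ => by
    rw [abs_mul, abs_of_pos (by positivity)]
  obtain ⟨K, hK⟩ := (isCompact_Icc.reProdIm isCompact_Icc).exists_bound_of_continuousOn
    (s := Set.Icc 0 1 ×ℂ Set.Icc (-τ) τ) (f := W) fun p hp => by
      refine (hWc p ?_).continuousWithinAt
      rw [Complex.mem_reProdIm] at hp
      exact (abs_le.mpr hp.2).trans_lt hτ
  have hlimR : Filter.Tendsto (fun ε : ℝ =>
      ∫ ξ : ℝ, realLaplace (besselJ n) (ε + 2 * π * ξ * Complex.I) * φ ξ)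
      (nhdsWithin 0 (Set.Ioi 0)) (nhds (∫ ξ : ℝ, W (2 * π * ξ * Complex.I) * φ ξ)) := by
    have hcongr : (fun ε : ℝ => ∫ ξ : ℝ, W (ε + 2 * π * ξ * Complex.I) * φ ξ)
        =ᶠ[nhdsWithin 0 (Set.Ioi 0)] fun ε : ℝ =>
          ∫ ξ : ℝ, realLaplace (besselJ n) (ε + 2 * π * ξ * Complex.I) * φ ξ := by
      filter_upwards [self_mem_nhdsWithin] with ε hε
      congr 1; ext ξ
      rw [realLaplace_besselJ_eq_besselRec n (by rw [hre]; exact hε), hW]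
    refine Filter.Tendsto.congr' hcongr ?_
    refine tendsto_integral_filter_of_dominated_convergence (fun ξ => K * ‖φ ξ‖) ?_ ?_
      (hφi.norm.const_mul K) ?_
    · filter_upwards [self_mem_nhdsWithin] with ε hε
      refine Continuous.aestronglyMeasurable (Continuous.mul ?_ hφc)
      have hslit : ∀ ξ : ℝ, 1 + ((ε : ℂ) + 2 * π * ξ * Complex.I) ^ 2 ∈ Complex.slitPlane :=
        fun ξ => one_add_sq_mem_slitPlane (Or.inl (by rw [hre]; exact hε))
      simp only [hW]
      refine Continuous.add (Continuous.mul ?_ (hA.comp (by fun_prop))) (hB.comp (by fun_prop))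
      exact Continuous.cpow (by fun_prop) continuous_const hslit
    · filter_upwards [Ioo_mem_nhdsGT one_pos] with ε hε
      refine Filter.Eventually.of_forall fun ξ => ?_
      rw [norm_mul]
      by_cases hξ : τ < 2 * π * |ξ|
      · rw [hφ0 ξ hξ]; simp
      · refine mul_le_mul_of_nonneg_right (hK _ ?_) (norm_nonneg _)
        rw [Complex.mem_reProdIm, hre, him]
        exact ⟨⟨hε.1.le, hε.2.le⟩, abs_le.mp (by rw [habs]; linarith)⟩
    · refine Filter.Eventually.of_forall fun ξ => ?_
      by_cases hξ : τ < 2 * π * |ξ|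
      · simp [hφ0 ξ hξ]
      · refine Filter.Tendsto.mul_const _ ?_
        have hc : ContinuousAt (fun ε : ℝ => W (ε + 2 * π * ξ * Complex.I)) 0 :=
          ContinuousAt.comp (hWc _ (by rw [him, habs]; linarith)) (by fun_prop)
        have h0 := hc.tendsto
        simp only [Complex.ofReal_zero, zero_add] at h0
        exact h0.mono_left nhdsWithin_le_nhds
  have hlim := tendsto_nhds_unique ((tendsto_integral_exp_neg_mul_besselJ_mul
    (h.1.continuous.comp Complex.continuous_ofReal) h.integrable n).congr' (by
      filter_upwards [self_mem_nhdsWithin] with ε hε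
        using integral_exp_neg_mul_besselJ_mul hφi hφH n hε)) hlimR
  rw [hlim]
  -- the part odd in `ξ` drops out
  have hodd : ∀ ξ : ℝ, W (2 * π * (-ξ : ℝ) * Complex.I) * φ (-ξ)
      = 2 * (besselRec 0 1 (2 * π * ξ * Complex.I) n * φ ξ)
        - W (2 * π * ξ * Complex.I) * φ ξ := by
    intro ξ
    have e1 : besselRec 0 1 (-(2 * π * ξ * Complex.I)) n
        = besselRec 0 1 (2 * π * ξ * Complex.I) n := by
      rw [hn, (besselRec_zero_one_eq _ l).1, (besselRec_zero_one_eq _ l).1]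
      refine Finset.sum_congr rfl fun j _ => ?_
      rw [mul_neg, Even.neg_pow ⟨j, by ring⟩]
    have e2 := besselRec_neg (2 * π * ξ * Complex.I) n
    rw [Odd.neg_one_pow ⟨l, hn⟩] at e2
    simp only [hW, Complex.ofReal_neg, mul_neg, neg_mul, neg_neg, even_two.neg_pow, e1, hφe] at e2 ⊢
    rw [e2]; ring
  have hBφ : Integrable fun ξ : ℝ => besselRec 0 1 (2 * π * ξ * Complex.I) n * φ ξ :=
    Continuous.integrable_of_hasCompactSupport
      ((hB.comp (f := fun ξ : ℝ => 2 * π * ξ * Complex.I) (by fun_prop)).mul hφc) hφs.mul_left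
  have hWφ : Integrable fun ξ : ℝ => W (2 * π * ξ * Complex.I) * φ ξ := by
    refine Integrable.mono' (hφi.norm.const_mul K) ?_ ?_
    · refine Continuous.aestronglyMeasurable ?_
      rw [continuous_iff_continuousAt]
      intro ξ
      by_cases hξ : τ < 2 * π * |ξ|
      · have hev : (fun ξ : ℝ => W (2 * π * ξ * Complex.I) * φ ξ) =ᶠ[nhds ξ] fun _ => 0 := by
          have ho : IsOpen {ξ : ℝ | τ < 2 * π * |ξ|} := isOpen_lt (by fun_prop) (by fun_prop)
          filter_upwards [ho.mem_nhds hξ] with η hη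
          rw [hφ0 η hη, mul_zero]
        exact (continuousAt_const).congr hev.symm
      · refine ContinuousAt.mul ?_ hφc.continuousAt
        refine ContinuousAt.comp (f := fun ξ : ℝ => 2 * π * ξ * Complex.I) (hWc _ ?_) (by fun_prop)
        have := him 0 ξ
        simp only [Complex.ofReal_zero, zero_add] at this
        rw [this, habs]; linarith
    · refine Filter.Eventually.of_forall fun ξ => ?_
      rw [norm_mul]
      by_cases hξ : τ < 2 * π * |ξ|
      · rw [hφ0 ξ hξ]; simp
      · refine mul_le_mul_of_nonneg_right (hK _ ?_) (norm_nonneg _)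
        have h1 := him 0 ξ
        have h2 := hre 0 ξ
        simp only [Complex.ofReal_zero, zero_add] at h1 h2
        rw [Complex.mem_reProdIm, h1, h2]
        exact ⟨⟨le_rfl, zero_le_one⟩, abs_le.mp (by rw [habs]; linarith)⟩
  have hsym : ∫ ξ : ℝ, W (2 * π * ξ * Complex.I) * φ ξ
      = ∫ ξ : ℝ, besselRec 0 1 (2 * π * ξ * Complex.I) n * φ ξ := by
    have h1 := integral_neg_eq_self (fun ξ : ℝ => W (2 * π * ξ * Complex.I) * φ ξ) volume
    simp only [hodd] at h1
    rw [integral_sub (hBφ.const_mul 2) hWφ, integral_const_mul] at h1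
    linear_combination -(1 / 2) * h1
  rw [hsym]
  simp only [hn, (besselRec_zero_one_eq _ l).1, Finset.sum_mul]
  rw [integral_finsetSum]
  · refine Finset.sum_congr rfl fun j _ => ?_
    rw [hφm j, ← integral_const_mul]
    congr 1; ext ξ
    rw [mul_pow 2]; ring
  · intro j _
    refine Continuous.integrable_of_hasCompactSupport (by fun_prop) hφs.mul_left

lemma contDiff_of_ofReal_eq_entire {h : ℝ → ℝ} {H : ℂ → ℂ} (hH : Differentiable ℂ H)
    (hh : ∀ x : ℝ, H x = h x) {n : ℕ∞} : ContDiff ℝ n h := by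
  have h1 : ContDiff ℝ n fun x : ℝ => (H x).re :=
    Complex.reCLM.contDiff.comp
      ((hH.contDiff.restrict_scalars ℝ).comp Complex.ofRealCLM.contDiff)
  simpa [hh] using h1

lemma iteratedDeriv_ofReal_comp {h : ℝ → ℝ} {n : ℕ} (hh : ContDiff ℝ n h) (x : ℝ) :
    iteratedDeriv n (fun y => (h y : ℂ)) x = ((iteratedDeriv n h x : ℝ) : ℂ) := by
  rw [iteratedDeriv_eq_iteratedFDeriv, iteratedDeriv_eq_iteratedFDeriv]
  have := Complex.ofRealCLM.iteratedFDeriv_comp_left hh.contDiffAt (x := x) le_rfl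
  have h2 := congrArg (fun T => T fun _ => 1) this
  simpa [Function.comp_def] using h2

lemma PaleyWienerBound.comp_inv_mul {τ lam : ℝ} {H : ℂ → ℂ} (h : PaleyWienerBound τ H)
    (hlam : 0 < lam) : PaleyWienerBound (τ / lam) fun z => H ((lam⁻¹ : ℝ) * z) := by
  obtain ⟨hd, C, hC⟩ := h
  have hC0 : 0 ≤ C := by simpa using (norm_nonneg _).trans (hC 0)
  refine ⟨hd.comp (by fun_prop), C * (1 + lam ^ 2), fun z => (hC _).trans ?_⟩
  rw [norm_mul, Complex.norm_real, Complex.im_ofReal_mul, abs_mul, Real.norm_eq_abs,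
    abs_of_pos (inv_pos.mpr hlam), show τ * (lam⁻¹ * |z.im|) = τ / lam * |z.im| by ring,
    div_le_div_iff₀ (by positivity) (by positivity)]
  have h1 : 1 + ‖z‖ ^ 2 ≤ (1 + lam ^ 2) * (1 + (lam⁻¹ * ‖z‖) ^ 2) := by
    have : (1 + lam ^ 2) * (1 + (lam⁻¹ * ‖z‖) ^ 2)
        = 1 + ‖z‖ ^ 2 + lam ^ 2 + (lam⁻¹ * ‖z‖) ^ 2 := by field_simp; ring
    rw [this]
    nlinarith [sq_nonneg lam, sq_nonneg (lam⁻¹ * ‖z‖)]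
  have h2 : 0 ≤ C * rexp (τ / lam * |z.im|) := by positivity
  nlinarith [mul_le_mul_of_nonneg_left h1 h2]

/-- Hankel transform of odd order of an even real function of exponential type `τ < lam`. -/
lemma PaleyWienerBound.integral_besselJ_mul {τ lam : ℝ} {H : ℂ → ℂ} (h : PaleyWienerBound τ H)
    (heven : ∀ z, H (-z) = H z) {f : ℝ → ℝ} (hf : ∀ x : ℝ, H x = f x) (hlam : 0 < lam)
    (hτ : τ < lam) (l : ℕ) :
    ∫ x in Set.Ioi (0 : ℝ), besselJ (2 * l + 1) (lam * x) * f x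
      = (1 / 2) * ∑ j ∈ Finset.range (l + 1), iteratedDeriv (2 * j) f 0 / ((2 * j).factorial : ℝ)
          * (((l + j).factorial : ℝ) / ((l - j).factorial : ℝ)) * (2 / lam) ^ (2 * j + 1) := by
  have hfc : ∀ n : ℕ, ContDiff ℝ n f := fun n => contDiff_of_ofReal_eq_entire (n := n) h.1 hf
  have hres : ∀ x : ℝ, H ((lam⁻¹ : ℝ) * (x : ℂ)) = (f (lam⁻¹ * x) : ℂ) := fun x => by
    rw [← hf, Complex.ofReal_mul]
  have key := (h.comp_inv_mul hlam).integral_mul_besselJ (fun z => by rw [mul_neg, heven])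
    ((div_lt_one hlam).mpr hτ) l
  simp only [hres] at key
  have hL : ∫ x in Set.Ioi (0 : ℝ), besselJ (2 * l + 1) x * f (lam⁻¹ * x)
      = ∑ j ∈ Finset.range (l + 1), ((l + j).choose (2 * j) : ℝ) * 2 ^ (2 * j)
          * (lam⁻¹ ^ (2 * j) * iteratedDeriv (2 * j) f 0) := by
    have hd : ∀ j, iteratedDeriv (2 * j) (fun x : ℝ => (f (lam⁻¹ * x) : ℂ)) 0
        = ((lam⁻¹ ^ (2 * j) * iteratedDeriv (2 * j) f 0 : ℝ) : ℂ) := fun j => by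
      rw [iteratedDeriv_ofReal_comp (h := fun x => f (lam⁻¹ * x)) ((hfc _).comp (by fun_prop)),
        iteratedDeriv_comp_const_mul (hfc _)]
      simp only [mul_zero]
    simp only [hd, ← Complex.ofReal_mul] at key
    rw [integral_complex_ofReal] at key
    exact_mod_cast key
  have hsc := integral_comp_mul_left_Ioi
    (fun x => besselJ (2 * l + 1) x * f (lam⁻¹ * x)) 0 hlam
  simp only [mul_zero, inv_mul_cancel_left₀ hlam.ne'] at hsc
  rw [hsc, hL, smul_eq_mul, Finset.mul_sum, Finset.mul_sum]
  refine Finset.sum_congr rfl fun j hj => ?_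
  have hj' : j ≤ l := Nat.lt_succ_iff.mp (Finset.mem_range.mp hj)
  rw [Nat.cast_choose ℝ (by lia : 2 * j ≤ l + j), show l + j - 2 * j = l - j by lia]
  have h1 : ((2 * j).factorial : ℝ) ≠ 0 := by positivity
  have h2 : ((l - j).factorial : ℝ) ≠ 0 := by positivity
  rw [div_pow, inv_pow]
  field_simp
  ring

lemma norm_betaIntegral_le {u : ℂ} {b : ℝ} (hu : 1 < u.re) (hb : 0 < b) :
    ‖u.betaIntegral b‖ ≤ Gamma b * (u.re - 1) ^ (-b) := by
  have hc : 0 < u.re - 1 := by linarith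
  have hval := Real.integral_rpow_mul_exp_neg_mul_Ioi hb hc
  have hint : IntegrableOn (fun t : ℝ => t ^ (b - 1) * rexp (-((u.re - 1) * t))) (Set.Ioi 0) := by
    refine Integrable.of_integral_ne_zero ?_
    rw [hval]
    have := Real.Gamma_pos_of_pos hb
    positivity
  have hint1 : IntervalIntegrable (fun t : ℝ => t ^ (b - 1) * rexp (-((u.re - 1) * t)))
      volume 0 1 :=
    (intervalIntegrable_iff_integrableOn_Ioc_of_le zero_le_one).mpr
      (hint.mono_set Set.Ioc_subset_Ioi_self)
  have h1 : ‖u.betaIntegral b‖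
      ≤ ∫ t in (0 : ℝ)..1, (1 - t) ^ (b - 1) * rexp (-((u.re - 1) * (1 - t))) := by
    refine intervalIntegral.norm_integral_le_of_norm_le zero_le_one
      (Filter.Eventually.of_forall fun t ht => ?_) ?_
    · have ht0 : 0 < t := ht.1
      have ht1 : 0 ≤ 1 - t := by linarith [ht.2]
      have e : (1 - (t : ℂ)) ^ ((b : ℂ) - 1) = (((1 - t) ^ (b - 1) : ℝ) : ℂ) := by
        rw [Complex.ofReal_cpow ht1]; push_cast; rfl
      rw [e, norm_mul, Complex.norm_cpow_eq_rpow_re_of_pos ht0, Complex.norm_real,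
        Real.norm_of_nonneg (by positivity), mul_comm]
      gcongr
      rw [Complex.sub_re, Complex.one_re, Real.rpow_def_of_pos ht0]
      gcongr
      nlinarith [Real.log_le_sub_one_of_pos ht0]
    · have := hint1.comp_sub_left 1
      simpa using this.symm
  refine h1.trans ?_
  rw [intervalIntegral.integral_comp_sub_left
    (fun t : ℝ => t ^ (b - 1) * rexp (-((u.re - 1) * t))) 1, sub_self, sub_zero,
    intervalIntegral.integral_of_le zero_le_one]
  refine (setIntegral_mono_set hint ?_
    (Filter.Eventually.of_forall Set.Ioc_subset_Ioi_self)).trans (le_of_eq ?_)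
  · refine (ae_restrict_iff' measurableSet_Ioi).mpr (Filter.Eventually.of_forall fun t ht => ?_)
    have ht : 0 < t := ht
    simp only [Pi.zero_apply]
    positivity
  · rw [hval, one_div, Real.inv_rpow hc.le, Real.rpow_neg hc.le]; ring

/-- The entire function `1 / (Γ(a + z) Γ(a - z))`. -/
noncomputable def recipGammaPair (a : ℝ) (z : ℂ) : ℂ :=
  (Complex.Gamma (a + z))⁻¹ * (Complex.Gamma (a - z))⁻¹

lemma differentiable_recipGammaPair (a : ℝ) : Differentiable ℂ (recipGammaPair a) :=
  (Complex.differentiable_one_div_Gamma.comp (by fun_prop : Differentiable ℂ fun z => (a : ℂ) + z)).mul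
    (Complex.differentiable_one_div_Gamma.comp (by fun_prop : Differentiable ℂ fun z => (a : ℂ) - z))

lemma recipGammaPair_neg (a : ℝ) (z : ℂ) : recipGammaPair a (-z) = recipGammaPair a z := by
  rw [recipGammaPair, recipGammaPair, sub_neg_eq_add, ← sub_eq_add_neg, mul_comm]

lemma recipGammaPair_eq_mul_add_one (a : ℝ) (z : ℂ) :
    recipGammaPair a z = ((a : ℂ) + z) * (a - z) * recipGammaPair (a + 1) z := by
  simp only [recipGammaPair]
  rw [Complex.one_div_Gamma_eq_self_mul_one_div_Gamma_add_one (a + z),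
    Complex.one_div_Gamma_eq_self_mul_one_div_Gamma_add_one (a - z)]
  push_cast
  rw [show (a : ℂ) + z + 1 = a + 1 + z by ring, show (a : ℂ) - z + 1 = a + 1 - z by ring]
  ring

lemma recipGammaPair_add_one_mul (a : ℝ) (z : ℂ) :
    recipGammaPair a (z + 1) * (a + z) = recipGammaPair a z * (a - z - 1) := by
  simp only [recipGammaPair]
  rw [Complex.one_div_Gamma_eq_self_mul_one_div_Gamma_add_one (a + z),
    Complex.one_div_Gamma_eq_self_mul_one_div_Gamma_add_one (a - (z + 1))]
  rw [show (a : ℂ) - (z + 1) + 1 = a - z by ring, show (a : ℂ) + (z + 1) = a + z + 1 by ring]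
  ring

lemma norm_sin_le (w : ℂ) : ‖Complex.sin w‖ ≤ rexp |w.im| := by
  rw [Complex.sin, norm_div, norm_mul, Complex.norm_I, mul_one, Complex.norm_ofNat,
    div_le_iff₀ two_pos]
  refine (norm_sub_le _ _).trans ?_
  rw [Complex.norm_exp, Complex.norm_exp]
  have h1 : rexp ((-w * Complex.I).re) ≤ rexp |w.im| := by
    gcongr; simpa using le_abs_self w.im
  have h2 : rexp ((w * Complex.I).re) ≤ rexp |w.im| := by
    gcongr; simpa using neg_le_abs w.im
  linarith

lemma norm_recipGammaPair_le_of_re_lt {a : ℝ} (ha : 1 / 2 < a) {z : ℂ} (hz : a < z.re) :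
    ‖recipGammaPair a z‖ ≤ rexp (π * |z.im|) * (z.re - a) ^ (1 - 2 * a) := by
  have hb : 0 < 2 * a - 1 := by linarith
  have hre : ((1 : ℂ) - (a - z)).re = 1 + (z.re - a) := by simp; ring
  have hG := Complex.betaIntegral_eq_Gamma_mul_div (1 - (a - z)) ((2 * a - 1 : ℝ) : ℂ)
    (by rw [hre]; linarith) (by rwa [Complex.ofReal_re])
  have hrefl := Complex.Gamma_mul_Gamma_one_sub ((a : ℂ) - z)
  have hΓ1 : Complex.Gamma (1 - (a - z)) ≠ 0 :=
    Complex.Gamma_ne_zero_of_re_pos (by rw [hre]; linarith)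
  have hΓb : Complex.Gamma ((2 * a - 1 : ℝ) : ℂ) ≠ 0 :=
    Complex.Gamma_ne_zero_of_re_pos (by rwa [Complex.ofReal_re])
  have hinv : (Complex.Gamma ((a : ℂ) - z))⁻¹
      = Complex.Gamma (1 - (a - z)) * Complex.sin (π * (a - z)) / π := by
    rw [eq_div_of_mul_eq hΓ1 hrefl]
    field_simp
  have key : recipGammaPair a z = (1 - (a - z) : ℂ).betaIntegral ((2 * a - 1 : ℝ) : ℂ)
      * Complex.sin (π * (a - z)) / (π * Complex.Gamma ((2 * a - 1 : ℝ) : ℂ)) := by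
    rw [recipGammaPair, hinv, hG,
      show (1 : ℂ) - (a - z) + ((2 * a - 1 : ℝ) : ℂ) = a + z by push_cast; ring]
    field_simp
  have hβ := norm_betaIntegral_le (u := 1 - (a - z)) (b := 2 * a - 1)
    (by rw [hre]; linarith) hb
  have hsin := norm_sin_le (π * (a - z))
  have him : |((π : ℂ) * (a - z)).im| = π * |z.im| := by
    rw [Complex.im_ofReal_mul]; simp [abs_mul, abs_of_pos pi_pos]
  rw [him] at hsin
  have hΓr := Real.Gamma_pos_of_pos hb
  rw [key, norm_div, norm_mul, norm_mul, Complex.Gamma_ofReal, Complex.norm_real,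
    Complex.norm_real, Real.norm_of_nonneg pi_pos.le, Real.norm_of_nonneg hΓr.le,
    div_le_iff₀ (by positivity)]
  rw [hre, add_sub_cancel_left, neg_sub] at hβ
  have hpos : 0 ≤ rexp (π * |z.im|) * (z.re - a) ^ (1 - 2 * a) * Gamma (2 * a - 1) := by
    have : 0 ≤ z.re - a := by linarith
    positivity
  calc _ ≤ Gamma (2 * a - 1) * (z.re - a) ^ (1 - 2 * a) * rexp (π * |z.im|) :=
        mul_le_mul hβ hsin (norm_nonneg _) (le_trans (norm_nonneg _) hβ)
    _ ≤ _ := by nlinarith [Real.pi_gt_three]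

/-- Polynomially weighted exponential type `π` bound. -/
lemma exists_norm_recipGammaPair_le_of_half_lt {a : ℝ} (ha : 1 / 2 < a) :
    ∃ C L : ℕ, ∀ z : ℂ, ‖recipGammaPair a z‖ ≤ C * (1 + ‖z‖) ^ L * rexp (π * |z.im|) := by
  have hcont := (differentiable_recipGammaPair a).continuous
  have hstep : ∀ n : ℕ, ∃ C L : ℕ, ∀ z : ℂ, a + 1 - n ≤ z.re →
      ‖recipGammaPair a z‖ ≤ C * (1 + ‖z‖) ^ L * rexp (π * |z.im|) := by
    intro n
    induction n with
    | zero =>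
      refine ⟨1, 0, fun z hz => ?_⟩
      have hz : a + 1 ≤ z.re := by simpa using hz
      refine (norm_recipGammaPair_le_of_re_lt ha (by linarith)).trans ?_
      have := Real.rpow_le_one_of_one_le_of_nonpos (x := z.re - a) (z := 1 - 2 * a)
        (by linarith) (by linarith)
      have he := exp_pos (π * |z.im|)
      simp only [Nat.cast_one, pow_zero, mul_one, one_mul]
      nlinarith
    | succ n ih =>
      obtain ⟨C, L, hCL⟩ := ih
      obtain ⟨K, hK⟩ := (isCompact_Icc.reProdIm isCompact_Icc).exists_bound_of_continuousOn
        (s := Set.Icc (a + 1 - (n + 1)) (a + 1 - n) ×ℂ Set.Icc (-1) 1) hcont.continuousOn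
      obtain ⟨N, hN⟩ := exists_nat_ge (max K (a + 1))
      refine ⟨C * 2 ^ L * N + C + N, L + 1, fun z hz => ?_⟩
      push_cast at hz ⊢
      have hz1 : 1 ≤ 1 + ‖z‖ := by linarith [norm_nonneg z]
      have hpow : (1 + ‖z‖) ^ L ≤ (1 + ‖z‖) ^ (L + 1) := pow_le_pow_right₀ hz1 (Nat.le_succ L)
      have hpow1 : 1 ≤ (1 + ‖z‖) ^ (L + 1) := one_le_pow₀ hz1
      have he1 : 1 ≤ rexp (π * |z.im|) := Real.one_le_exp (by positivity)
      have hNK : K ≤ N := (le_max_left _ _).trans hN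
      have hNa : a + 1 ≤ N := (le_max_right _ _).trans hN
      rcases le_or_gt (a + 1 - n) z.re with h1 | h1
      · refine (hCL z h1).trans ?_
        gcongr
        nlinarith [show (0 : ℝ) ≤ C * 2 ^ L * N by positivity]
      rcases le_or_gt |z.im| 1 with h2 | h2
      · refine (hK z ?_).trans ?_
        · rw [Complex.mem_reProdIm]
          exact ⟨⟨hz, h1.le⟩, abs_le.mp h2⟩
        · calc K ≤ (N : ℝ) * 1 * 1 := by linarith
            _ ≤ _ := by
              gcongr
              nlinarith [show (0 : ℝ) ≤ C * 2 ^ L * N by positivity,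
                show (0 : ℝ) ≤ C by positivity]
      · have hden : 1 ≤ ‖(a : ℂ) - z - 1‖ := by
          refine h2.le.trans ?_
          have := Complex.abs_im_le_norm ((a : ℂ) - z - 1)
          simpa using this
        have hs := hCL (z + 1) (by simp; linarith)
        have him : (z + 1).im = z.im := by simp
        rw [him] at hs
        have hn1 : 1 + ‖z + 1‖ ≤ 2 * (1 + ‖z‖) := by
          have := norm_add_le z 1
          rw [norm_one] at this
          linarith [norm_nonneg z]
        have hn2 : ‖(a : ℂ) + z‖ ≤ N * (1 + ‖z‖) := by
          have := norm_add_le (a : ℂ) z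
          rw [Complex.norm_real, Real.norm_of_nonneg (by linarith)] at this
          nlinarith [norm_nonneg z]
        calc ‖recipGammaPair a z‖ ≤ ‖recipGammaPair a z‖ * ‖(a : ℂ) - z - 1‖ :=
              le_mul_of_one_le_right (norm_nonneg _) hden
          _ = ‖recipGammaPair a (z + 1)‖ * ‖(a : ℂ) + z‖ := by
              rw [← norm_mul, ← norm_mul, recipGammaPair_add_one_mul]
          _ ≤ (C * (2 * (1 + ‖z‖)) ^ L * rexp (π * |z.im|)) * (N * (1 + ‖z‖)) := by
              gcongr
              exact hs.trans (by gcongr)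
          _ = (C * 2 ^ L * N) * (1 + ‖z‖) ^ (L + 1) * rexp (π * |z.im|) := by
              rw [mul_pow]; ring
          _ ≤ _ := by
              gcongr
              have : (0 : ℝ) ≤ C := by positivity
              have : (0 : ℝ) ≤ N := by positivity
              linarith
  obtain ⟨n, hn⟩ := exists_nat_ge (a + 1)
  obtain ⟨C, L, hCL⟩ := hstep n
  refine ⟨C, L, fun z => ?_⟩
  rcases le_total 0 z.re with h | h
  · exact hCL z (by linarith)
  · have := hCL (-z) (by rw [Complex.neg_re]; linarith)
    rwa [recipGammaPair_neg, norm_neg, Complex.neg_im, abs_neg] at this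

lemma norm_add_mul_sub_le {a : ℝ} (ha : 0 < a) (z : ℂ) :
    ‖((a : ℂ) + z) * (a - z)‖ ≤ (1 + a) ^ 2 * (1 + ‖z‖) ^ 2 := by
  have h1 := norm_add_le (a : ℂ) z
  have h2 := norm_sub_le (a : ℂ) z
  rw [Complex.norm_real, Real.norm_of_nonneg ha.le] at h1 h2
  have h3 : a + ‖z‖ ≤ (1 + a) * (1 + ‖z‖) := by nlinarith [norm_nonneg z]
  rw [norm_mul, ← mul_pow, sq]
  exact mul_le_mul (h1.trans h3) (h2.trans h3) (norm_nonneg _) (by positivity)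

lemma exists_norm_recipGammaPair_le {a : ℝ} (ha : 0 < a) :
    ∃ (C : ℝ) (L : ℕ), ∀ z : ℂ,
      ‖recipGammaPair a z‖ ≤ C * (1 + ‖z‖) ^ L * rexp (π * |z.im|) := by
  obtain ⟨C, L, h⟩ := exists_norm_recipGammaPair_le_of_half_lt (a := a + 1) (by linarith)
  refine ⟨(1 + a) ^ 2 * C, 2 + L, fun z => ?_⟩
  rw [recipGammaPair_eq_mul_add_one, norm_mul]
  calc _ ≤ ((1 + a) ^ 2 * (1 + ‖z‖) ^ 2) * (C * (1 + ‖z‖) ^ L * rexp (π * |z.im|)) :=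
        mul_le_mul (norm_add_mul_sub_le ha z) (h z) (norm_nonneg _) (by positivity)
    _ = _ := by ring

lemma exists_norm_recipGammaPair_ofReal_le_of_half_lt {a : ℝ} (ha : 1 / 2 < a) :
    ∃ C : ℝ, 0 ≤ C ∧ ∀ x : ℝ, ‖recipGammaPair a x‖ ≤ C * (1 + |x|) ^ (1 - 2 * a) := by
  have hcont : Continuous fun x : ℝ => recipGammaPair a x :=
    (differentiable_recipGammaPair a).continuous.comp Complex.continuous_ofReal
  have hcont2 : Continuous fun x : ℝ => recipGammaPair a x * ((1 + |x|) ^ (2 * a - 1) : ℝ) :=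
    hcont.mul (Complex.continuous_ofReal.comp (Continuous.rpow_const (by fun_prop)
      fun x => Or.inl (by positivity)))
  obtain ⟨K, hK⟩ := (isCompact_Icc (a := (0 : ℝ)) (b := a + 1)).exists_bound_of_continuousOn
    hcont2.continuousOn
  have hK0 : 0 ≤ K := (norm_nonneg _).trans (hK 0 ⟨le_rfl, by linarith⟩)
  refine ⟨K + (a + 2) ^ (2 * a - 1), by positivity, fun x => ?_⟩
  wlog hx : 0 ≤ x generalizing x with hw
  · have := hw (-x) (by linarith)
    rwa [Complex.ofReal_neg, recipGammaPair_neg, abs_neg] at this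
  have hp : 0 < (1 + x) ^ (1 - 2 * a) := by positivity
  rw [abs_of_nonneg hx]
  rcases le_total x (a + 1) with h | h
  · have h1 := hK x ⟨hx, h⟩
    rw [norm_mul, Complex.norm_real, Real.norm_of_nonneg (by positivity), abs_of_nonneg hx] at h1
    have h2 : (1 + x) ^ (2 * a - 1) * (1 + x) ^ (1 - 2 * a) = 1 := by
      rw [← Real.rpow_add (by positivity)]; simp
    have h3 := mul_le_mul_of_nonneg_right h1 hp.le
    rw [mul_assoc, h2, mul_one] at h3
    have : 0 ≤ (a + 2) ^ (2 * a - 1) * (1 + x) ^ (1 - 2 * a) := by positivity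
    linarith
  · have h1 := norm_recipGammaPair_le_of_re_lt ha (z := x) (by rw [Complex.ofReal_re]; linarith)
    rw [Complex.ofReal_im, abs_zero, mul_zero, Real.exp_zero, one_mul, Complex.ofReal_re] at h1
    have h2 : (1 + x) / (a + 2) ≤ x - a := by
      rw [div_le_iff₀ (by linarith)]; nlinarith
    have h3 : (x - a) ^ (1 - 2 * a) ≤ ((1 + x) / (a + 2)) ^ (1 - 2 * a) :=
      Real.rpow_le_rpow_of_nonpos (by positivity) h2 (by linarith)
    rw [Real.div_rpow (by positivity) (by positivity), div_eq_mul_inv,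
      ← Real.rpow_neg (by positivity), neg_sub] at h3
    have : 0 ≤ K * (1 + x) ^ (1 - 2 * a) := by positivity
    linarith

/-- Decay of `1 / (Γ(a + x) Γ(a - x))` on the real line. -/
lemma exists_norm_recipGammaPair_ofReal_le {a : ℝ} (ha : 0 < a) :
    ∃ C : ℝ, 0 ≤ C ∧ ∀ x : ℝ, ‖recipGammaPair a x‖ ≤ C * (1 + |x|) ^ (1 - 2 * a) := by
  obtain ⟨C, hC, h⟩ := exists_norm_recipGammaPair_ofReal_le_of_half_lt (a := a + 1) (by linarith)
  refine ⟨(1 + a) ^ 2 * C, by positivity, fun x => ?_⟩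
  have h1 := norm_add_mul_sub_le ha x
  rw [Complex.norm_real, Real.norm_eq_abs] at h1
  rw [recipGammaPair_eq_mul_add_one, norm_mul]
  calc _ ≤ ((1 + a) ^ 2 * (1 + |x|) ^ 2) * (C * (1 + |x|) ^ (1 - 2 * (a + 1))) :=
        mul_le_mul h1 (h x) (norm_nonneg _) (by positivity)
    _ = (1 + a) ^ 2 * C * ((1 + |x|) ^ (2 : ℝ) * (1 + |x|) ^ (1 - 2 * (a + 1))) := by
        rw [Real.rpow_two]; ring
    _ = _ := by
        rw [← Real.rpow_add (by positivity)]; congr 2; ring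

lemma recipGammaPair_ofReal (a x : ℝ) :
    recipGammaPair a x = (((Gamma (a + x) * Gamma (a - x))⁻¹ : ℝ) : ℂ) := by
  rw [recipGammaPair, ← Complex.ofReal_add, ← Complex.ofReal_sub, Complex.Gamma_ofReal,
    Complex.Gamma_ofReal, mul_inv]
  push_cast; rfl

lemma mul_recipGammaPair_one (w : ℂ) :
    w * recipGammaPair 1 w = Complex.sin (π * w) / π := by
  rw [recipGammaPair, Complex.ofReal_one, ← mul_assoc, add_comm 1 w,
    ← Complex.one_div_Gamma_eq_self_mul_one_div_Gamma_add_one, ← mul_inv,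
    Complex.Gamma_mul_Gamma_one_sub, inv_div]

lemma exists_norm_recipGammaPair_one_le :
    ∃ C : ℝ, ∀ w : ℂ, ‖recipGammaPair 1 w‖ ≤ C * rexp (π * |w.im|) / (1 + ‖w‖) := by
  obtain ⟨K, hK⟩ := (isCompact_closedBall (0 : ℂ) 1).exists_bound_of_continuousOn
    (differentiable_recipGammaPair 1).continuous.continuousOn
  have hK0 : 0 ≤ K := (norm_nonneg _).trans (hK 0 (by simp))
  refine ⟨2 * K + 1, fun w => ?_⟩
  have he1 : 1 ≤ rexp (π * |w.im|) := Real.one_le_exp (by positivity)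
  rw [le_div_iff₀ (by positivity)]
  rcases le_total ‖w‖ 1 with h | h
  · have h1 := hK w (by simpa using h)
    calc _ ≤ K * 2 := by gcongr; linarith
      _ ≤ (2 * K + 1) * 1 := by linarith
      _ ≤ _ := by gcongr
  · have h1 := congrArg norm (mul_recipGammaPair_one w)
    have h2 := norm_sin_le (π * w)
    rw [Complex.im_ofReal_mul, abs_mul, abs_of_pos pi_pos] at h2
    rw [norm_mul, norm_div, Complex.norm_real, Real.norm_of_nonneg pi_pos.le,
      eq_div_iff pi_ne_zero] at h1
    have h3 : 0 ≤ ‖w‖ * ‖recipGammaPair 1 w‖ := by positivity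
    have h4 : ‖w‖ * ‖recipGammaPair 1 w‖ * 2 ≤ rexp (π * |w.im|) := by
      nlinarith [Real.pi_gt_three]
    nlinarith [norm_nonneg (recipGammaPair 1 w)]

/-- Multiplying by a high power of a dilated `sinc` turns polynomial growth into decay. -/
lemma paleyWienerBound_mul_recipGammaPair_pow {F : ℂ → ℂ} (hF : Differentiable ℂ F)
    {C τ : ℝ} {L : ℕ} (hFb : ∀ z, ‖F z‖ ≤ C * (1 + ‖z‖) ^ L * rexp (τ * |z.im|))
    {δ : ℝ} (hδ : 0 < δ) (hδ1 : δ ≤ 1) :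
    PaleyWienerBound (τ + (L + 2 : ℕ) * (π * δ))
      fun z => F z * recipGammaPair 1 (δ * z) ^ (L + 2) := by
  obtain ⟨K, hK⟩ := exists_norm_recipGammaPair_one_le
  have hC0 : 0 ≤ C := by simpa using (norm_nonneg _).trans (hFb 0)
  have hK0 : 0 ≤ K := by simpa using (norm_nonneg _).trans (hK 0)
  refine ⟨hF.mul (((differentiable_recipGammaPair 1).comp (by fun_prop)).pow _),
    C * (K / δ) ^ (L + 2), fun z => ?_⟩
  have h1 : ‖recipGammaPair 1 (δ * z)‖ ≤ K / δ * rexp (π * δ * |z.im|) / (1 + ‖z‖) := by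
    have h2 := hK (δ * z)
    rw [Complex.im_ofReal_mul, abs_mul, norm_mul, Complex.norm_real, Real.norm_eq_abs,
      abs_of_pos hδ, ← mul_assoc] at h2
    refine h2.trans ?_
    rw [div_mul_eq_mul_div, div_div]
    refine div_le_div_of_nonneg_left (by positivity) (by positivity) ?_
    nlinarith [norm_nonneg z]
  have hz : 0 < 1 + ‖z‖ := by positivity
  calc _ = ‖F z‖ * ‖recipGammaPair 1 (δ * z)‖ ^ (L + 2) := by rw [norm_mul, norm_pow]
    _ ≤ (C * (1 + ‖z‖) ^ L * rexp (τ * |z.im|))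
          * (K / δ * rexp (π * δ * |z.im|) / (1 + ‖z‖)) ^ (L + 2) := by
        gcongr
        exact hFb z
    _ = C * (K / δ) ^ (L + 2) * rexp ((τ + (L + 2 : ℕ) * (π * δ)) * |z.im|)
          / (1 + ‖z‖) ^ 2 := by
        rw [add_mul, Real.exp_add, mul_assoc ((L + 2 : ℕ) : ℝ), Real.exp_nat_mul, div_pow, mul_pow,
          pow_add (1 + ‖z‖)]
        field_simp
    _ ≤ _ := by
        gcongr
        nlinarith [norm_nonneg z]

lemma exists_one_add_mul_rpow_le {b : ℝ} (hb : 0 < b) (r : ℝ) :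
    ∃ c : ℝ, 0 ≤ c ∧ ∀ t : ℝ, 0 ≤ t → (1 + b * t) ^ r ≤ c * (1 + t) ^ r := by
  rcases le_total 0 r with hr | hr
  · refine ⟨(1 + b) ^ r, by positivity, fun t ht => ?_⟩
    rw [← Real.mul_rpow (by positivity) (by positivity)]
    exact Real.rpow_le_rpow (by positivity) (by nlinarith) hr
  · refine ⟨(b / (1 + b)) ^ r, by positivity, fun t ht => ?_⟩
    rw [← Real.mul_rpow (by positivity) (by positivity)]
    refine Real.rpow_le_rpow_of_nonpos (by positivity) ?_ hr
    rw [div_mul_eq_mul_div, div_le_iff₀ (by positivity)]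
    nlinarith [mul_nonneg hb.le ht, mul_nonneg (mul_nonneg hb.le hb.le) ht]

/-- Hankel transform of odd order of an even function of exponential type at most `lam` whose
product with a Bessel function is integrable. -/
theorem integral_besselJ_mul_of_exponential_type {F : ℂ → ℂ} (hF : Differentiable ℂ F)
    (heven : ∀ z, F (-z) = F z) {C τ : ℝ} {L : ℕ}
    (hFb : ∀ z, ‖F z‖ ≤ C * (1 + ‖z‖) ^ L * rexp (τ * |z.im|))
    {f : ℝ → ℝ} (hf : ∀ x : ℝ, F x = f x) {D κ : ℝ}
    (hfb : ∀ x, 0 ≤ x → |f x| ≤ D * (1 + x) ^ κ) (hκ : κ < -(1 / 2))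
    {lam : ℝ} (hlam : 0 < lam) (hτ : τ ≤ lam) (l : ℕ) :
    ∫ x in Set.Ioi (0 : ℝ), besselJ (2 * l + 1) (lam * x) * f x
      = (1 / 2) * ∑ j ∈ Finset.range (l + 1), iteratedDeriv (2 * j) f 0 / ((2 * j).factorial : ℝ)
          * (((l + j).factorial : ℝ) / ((l - j).factorial : ℝ)) * (2 / lam) ^ (2 * j + 1) := by
  have hD0 : 0 ≤ D := by simpa using (abs_nonneg _).trans (hfb 0 le_rfl)
  have hfs : ∀ n : ℕ, ContDiff ℝ n f := fun n => contDiff_of_ofReal_eq_entire (n := n) hF hf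
  obtain ⟨S, hS⟩ : ∃ S : ℝ → ℝ, ∀ x, S x = ((Gamma (1 + x) * Gamma (1 - x))⁻¹) ^ (L + 2) :=
    ⟨_, fun _ => rfl⟩
  have hSG : ∀ x : ℝ, recipGammaPair 1 x ^ (L + 2) = S x := fun x => by
    rw [recipGammaPair_ofReal, hS, Complex.ofReal_pow]
  have hSs : ∀ n : ℕ, ContDiff ℝ n S := fun n =>
    contDiff_of_ofReal_eq_entire (n := n) ((differentiable_recipGammaPair 1).pow (L + 2)) hSG
  have hS0 : S 0 = 1 := by simp [hS]
  obtain ⟨K, hK0, hK⟩ := exists_norm_recipGammaPair_ofReal_le one_pos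
  have hSb : ∀ x, |S x| ≤ K ^ (L + 2) := fun x => by
    have h1 := congrArg norm (hSG x)
    rw [Complex.norm_real, norm_pow, Real.norm_eq_abs] at h1
    rw [← h1]
    gcongr
    refine (hK x).trans (mul_le_of_le_one_right hK0 ?_)
    exact Real.rpow_le_one_of_one_le_of_nonpos (by linarith [abs_nonneg x]) (by norm_num)
  obtain ⟨lamd, hlamd⟩ : ∃ lamd : ℝ → ℝ, ∀ δ, lamd δ = lam + (L + 3 : ℕ) * (π * δ) :=
    ⟨_, fun _ => rfl⟩
  have hlamc : Continuous lamd := by rw [funext hlamd]; fun_prop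
  have hlam0 : lamd 0 = lam := by simp [hlamd]
  have hlam_le : ∀ δ, 0 ≤ δ → lam ≤ lamd δ := fun δ hδ => by
    rw [hlamd]
    have : 0 ≤ ((L + 3 : ℕ) : ℝ) * (π * δ) := by positivity
    linarith
  have hreg : ∀ δ ∈ Set.Ioo (0 : ℝ) 1,
      ∫ x in Set.Ioi (0 : ℝ), besselJ (2 * l + 1) (lamd δ * x) * (f x * S (δ * x))
        = (1 / 2) * ∑ j ∈ Finset.range (l + 1),
          iteratedDeriv (2 * j) (fun x => f x * S (δ * x)) 0 / ((2 * j).factorial : ℝ)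
          * (((l + j).factorial : ℝ) / ((l - j).factorial : ℝ)) * (2 / lamd δ) ^ (2 * j + 1) := by
    intro δ hδ
    refine (paleyWienerBound_mul_recipGammaPair_pow hF hFb hδ.1 hδ.2.le).integral_besselJ_mul
      (fun z => ?_) (fun x => ?_) (hlam.trans_le (hlam_le δ hδ.1.le)) ?_ l
    · rw [heven, mul_neg, recipGammaPair_neg]
    · rw [hf, ← Complex.ofReal_mul, hSG, ← Complex.ofReal_mul]
    · rw [hlamd]
      push_cast
      nlinarith [mul_pos pi_pos hδ.1]
  have hL : Filter.Tendsto (fun δ : ℝ =>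
      ∫ x in Set.Ioi (0 : ℝ), besselJ (2 * l + 1) (lamd δ * x) * (f x * S (δ * x)))
      (nhdsWithin 0 (Set.Ioi 0))
      (nhds (∫ x in Set.Ioi (0 : ℝ), besselJ (2 * l + 1) (lam * x) * f x)) := by
    have hJc := continuous_besselJ (2 * l + 1)
    have hfc : Continuous f := (hfs 0).continuous
    have hSc : Continuous S := (hSs 0).continuous
    obtain ⟨B, hB0, hB⟩ := exists_besselJ_bound (2 * l + 1)
    obtain ⟨c, hc0, hc⟩ := exists_one_add_mul_rpow_le hlam (-(1 / 2))
    refine tendsto_integral_filter_of_dominated_convergence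
      (fun x => B * c * D * K ^ (L + 2) * (1 + ‖x‖) ^ (-(1 / 2 - κ))) ?_ ?_ ?_ ?_
    · refine Filter.Eventually.of_forall fun δ => Continuous.aestronglyMeasurable ?_
      fun_prop
    · filter_upwards [self_mem_nhdsWithin] with δ hδ
      refine (ae_restrict_iff' measurableSet_Ioi).mpr (Filter.Eventually.of_forall fun x hx => ?_)
      have hx : 0 < x := hx
      have hδ : 0 < δ := hδ
      have hle := hlam_le δ hδ.le
      have h1 : |besselJ (2 * l + 1) (lamd δ * x)| ≤ B * (c * (1 + x) ^ (-(1 / 2) : ℝ)) := by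
        refine (hB _ (by nlinarith)).trans ?_
        gcongr
        refine le_trans ?_ (hc x hx.le)
        exact Real.rpow_le_rpow_of_nonpos (by positivity) (by nlinarith) (by norm_num)
      rw [Real.norm_eq_abs, abs_mul, abs_mul, Real.norm_eq_abs, abs_of_pos hx]
      calc _ ≤ (B * (c * (1 + x) ^ (-(1 / 2) : ℝ))) * (D * (1 + x) ^ κ * K ^ (L + 2)) := by
            gcongr
            · exact hfb x hx.le
            · exact hSb _
        _ = B * c * D * K ^ (L + 2) * ((1 + x) ^ (-(1 / 2) : ℝ) * (1 + x) ^ κ) := by ring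
        _ = _ := by rw [← Real.rpow_add (by positivity)]; congr 2; ring
    · refine (Integrable.const_mul ?_ _).integrableOn
      exact integrable_one_add_norm (by simp; linarith)
    · refine Filter.Eventually.of_forall fun x => ?_
      have hcx : Continuous fun δ : ℝ =>
          besselJ (2 * l + 1) (lamd δ * x) * (f x * S (δ * x)) := by fun_prop
      have h0 := hcx.tendsto 0
      simp only [hlam0, zero_mul, hS0, mul_one] at h0
      exact h0.mono_left nhdsWithin_le_nhds
  have hDer : ∀ n, Filter.Tendsto (fun δ : ℝ => iteratedDeriv n (fun x => f x * S (δ * x)) 0)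
      (nhds 0) (nhds (iteratedDeriv n f 0)) := by
    intro n
    have hform : ∀ δ : ℝ, iteratedDeriv n (fun x => f x * S (δ * x)) 0
        = ∑ i ∈ Finset.range (n + 1), (n.choose i : ℝ) * iteratedDeriv i f 0
          * (δ ^ (n - i) * iteratedDeriv (n - i) S 0) := fun δ => by
      rw [iteratedDeriv_fun_mul (g := fun x => S (δ * x)) (hfs n).contDiffAt
        ((hSs n).comp (by fun_prop)).contDiffAt]
      refine Finset.sum_congr rfl fun i _ => ?_
      rw [iteratedDeriv_comp_const_mul (hSs _)]
      simp only [mul_zero]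
    have hcont : Continuous fun δ : ℝ => iteratedDeriv n (fun x => f x * S (δ * x)) 0 := by
      simp only [hform]; fun_prop
    simpa [hS0] using hcont.tendsto 0
  have hR : Filter.Tendsto (fun δ : ℝ => (1 / 2) * ∑ j ∈ Finset.range (l + 1),
          iteratedDeriv (2 * j) (fun x => f x * S (δ * x)) 0 / ((2 * j).factorial : ℝ)
          * (((l + j).factorial : ℝ) / ((l - j).factorial : ℝ)) * (2 / lamd δ) ^ (2 * j + 1))
      (nhds 0) (nhds ((1 / 2) * ∑ j ∈ Finset.range (l + 1),
          iteratedDeriv (2 * j) f 0 / ((2 * j).factorial : ℝ)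
          * (((l + j).factorial : ℝ) / ((l - j).factorial : ℝ)) * (2 / lam) ^ (2 * j + 1))) := by
    refine (tendsto_finsetSum _ fun j _ => ?_).const_mul _
    refine (((hDer _).div_const _).mul_const _).mul (Filter.Tendsto.pow ?_ _)
    refine tendsto_const_nhds.div ?_ hlam.ne'
    simpa [hlam0] using hlamc.tendsto 0
  refine tendsto_nhds_unique hL ((hR.mono_left nhdsWithin_le_nhds).congr' ?_)
  filter_upwards [Ioo_mem_nhdsGT one_pos] with δ hδ using (hreg δ hδ).symm

lemma exists_norm_prod_recipGammaPair_le (s : Finset ℕ) {α β : ℕ → ℝ}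
    (hα : ∀ k ∈ s, 0 < α k) (hβ : ∀ k ∈ s, 0 < β k) :
    ∃ (C : ℝ) (L : ℕ), ∀ z : ℂ, ‖∏ k ∈ s, recipGammaPair (α k) (β k * z)‖
      ≤ C * (1 + ‖z‖) ^ L * rexp (π * (∑ k ∈ s, β k) * |z.im|) := by
  induction s using Finset.cons_induction with
  | empty => exact ⟨1, 0, fun z => by simp⟩
  | cons k s hk ih =>
    simp only [Finset.mem_cons, forall_eq_or_imp] at hα hβ
    obtain ⟨C, L, h⟩ := ih hα.2 hβ.2
    obtain ⟨C', L', h'⟩ := exists_norm_recipGammaPair_le hα.1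
    have hC : 0 ≤ C := by simpa using (norm_nonneg _).trans (h 0)
    have hC' : 0 ≤ C' := by simpa using (norm_nonneg _).trans (h' 0)
    have hβk := hβ.1
    refine ⟨C' * (1 + β k) ^ L' * C, L' + L, fun z => ?_⟩
    rw [Finset.prod_cons, Finset.sum_cons, norm_mul]
    have h1 : ‖recipGammaPair (α k) (β k * z)‖
        ≤ C' * ((1 + β k) * (1 + ‖z‖)) ^ L' * rexp (π * β k * |z.im|) := by
      have h2 := h' (β k * z)
      rw [Complex.im_ofReal_mul, abs_mul, norm_mul, Complex.norm_real, Real.norm_eq_abs,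
        abs_of_pos hβk, ← mul_assoc π] at h2
      refine h2.trans ?_
      gcongr
      nlinarith [norm_nonneg z]
    refine (mul_le_mul h1 (h z) (norm_nonneg _) (by positivity)).trans (le_of_eq ?_)
    rw [mul_add π, add_mul (π * β k), Real.exp_add, mul_pow, pow_add]
    ring

lemma exists_norm_prod_recipGammaPair_ofReal_le (s : Finset ℕ) {α β : ℕ → ℝ}
    (hα : ∀ k ∈ s, 0 < α k) (hβ : ∀ k ∈ s, 0 < β k) :
    ∃ C : ℝ, 0 ≤ C ∧ ∀ x : ℝ, 0 ≤ x → ‖∏ k ∈ s, recipGammaPair (α k) (β k * x)‖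
      ≤ C * (1 + x) ^ (∑ k ∈ s, (1 - 2 * α k)) := by
  induction s using Finset.cons_induction with
  | empty => exact ⟨1, zero_le_one, fun x _ => by simp⟩
  | cons k s hk ih =>
    simp only [Finset.mem_cons, forall_eq_or_imp] at hα hβ
    obtain ⟨C, hC, h⟩ := ih hα.2 hβ.2
    obtain ⟨C', hC', h'⟩ := exists_norm_recipGammaPair_ofReal_le hα.1
    obtain ⟨c, hc, hcb⟩ := exists_one_add_mul_rpow_le hβ.1 (1 - 2 * α k)
    refine ⟨C' * c * C, by positivity, fun x hx => ?_⟩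
    rw [Finset.prod_cons, Finset.sum_cons, norm_mul]
    have h1 : ‖recipGammaPair (α k) (β k * x)‖ ≤ C' * (c * (1 + x) ^ (1 - 2 * α k)) := by
      have h2 := h' (β k * x)
      rw [abs_of_nonneg (mul_nonneg hβ.1.le hx), Complex.ofReal_mul] at h2
      refine h2.trans ?_
      gcongr
      exact hcb x hx
    refine (mul_le_mul h1 (h x hx) (norm_nonneg _) (by positivity)).trans (le_of_eq ?_)
    rw [Real.rpow_add (by positivity)]
    ring

lemma iteratedDeriv_pow_mul_zero {g : ℝ → ℝ} (hg : ∀ n : ℕ, ContDiff ℝ n g) (n p : ℕ) :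
    iteratedDeriv n (fun x => x ^ p * g x) 0
      = if p ≤ n then (n.choose p : ℝ) * p.factorial * iteratedDeriv (n - p) g 0 else 0 := by
  rw [iteratedDeriv_fun_mul (f := fun x : ℝ => x ^ p) (by fun_prop) (hg n).contDiffAt]
  have hterm : ∀ i ∈ Finset.range (n + 1), i ≠ p →
      (n.choose i : ℝ) * iteratedDeriv i (fun x : ℝ => x ^ p) 0 * iteratedDeriv (n - i) g 0 = 0 := by
    intro i _ hi
    rw [iteratedDeriv_pow]
    rcases lt_or_gt_of_ne hi with h | h
    · rw [zero_pow (by lia)]; simp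
    · rw [Nat.descFactorial_eq_zero_iff_lt.mpr h]; simp
  split_ifs with hp
  · rw [Finset.sum_eq_single_of_mem p (Finset.mem_range.mpr (by lia)) hterm, iteratedDeriv_pow,
      Nat.descFactorial_self]
    simp
  · exact Finset.sum_eq_zero fun i hi => hterm i hi (by have := Finset.mem_range.mp hi; lia)

theorem hankel_gamma_terminating_odd_order
    (M : ℕ) (hM : 1 ≤ M) (α β : ℕ → ℝ)
    (hα : ∀ k ∈ Finset.range M, 0 < α k) (hβ : ∀ k ∈ Finset.range M, 0 < β k)
    (m l : ℕ) (hl : m ≤ l)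
    (hαsum : (m : ℝ) + (1 / 2) * ((M : ℝ) + 1 / 2) < ∑ k ∈ Finset.range M, α k)
    (lam : ℝ) (hlam : π * ∑ k ∈ Finset.range M, β k ≤ lam) :
    ∫ x in Set.Ioi (0 : ℝ), x ^ (2 * m) * besselJ (2 * l + 1) (lam * x) * gammaProd M α β x
      = (1 / 2) * ∑ s ∈ Finset.range (l - m + 1),
          (iteratedDeriv (2 * s) (gammaProd M α β) 0 / (Nat.factorial (2 * s) : ℝ))
            * ((Nat.factorial (l + m + s) : ℝ) / (Nat.factorial (l - m - s) : ℝ))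
            * (2 / lam) ^ (2 * m + 2 * s + 1) := by
  have hlam0 : 0 < lam := by
    refine lt_of_lt_of_le (mul_pos pi_pos (Finset.sum_pos hβ ?_)) hlam
    exact Finset.nonempty_range_iff.mpr (by lia)
  obtain ⟨P, hP⟩ : ∃ P : ℂ → ℂ, ∀ z, P z = ∏ k ∈ Finset.range M, recipGammaPair (α k) (β k * z) :=
    ⟨_, fun _ => rfl⟩
  have hPd : Differentiable ℂ P := by
    rw [funext hP]
    exact Differentiable.fun_finsetProd fun k _ =>
      (differentiable_recipGammaPair (α k)).comp (by fun_prop)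
  have hPe : ∀ z, P (-z) = P z := fun z => by
    simp only [hP, mul_neg, recipGammaPair_neg]
  have hPr : ∀ x : ℝ, P x = (gammaProd M α β x : ℂ) := fun x => by
    simp only [hP, gammaProd, ← Complex.ofReal_mul, recipGammaPair_ofReal, Complex.ofReal_prod]
  have hgs : ∀ n : ℕ, ContDiff ℝ n (gammaProd M α β) := fun n =>
    contDiff_of_ofReal_eq_entire (n := n) hPd hPr
  obtain ⟨C, L, hC⟩ := exists_norm_prod_recipGammaPair_le (Finset.range M) hα hβ
  obtain ⟨D, hD0, hD⟩ := exists_norm_prod_recipGammaPair_ofReal_le (Finset.range M) hα hβ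
  have key := integral_besselJ_mul_of_exponential_type (F := fun z => z ^ (2 * m) * P z)
    (f := fun x => x ^ (2 * m) * gammaProd M α β x) (by fun_prop)
    (fun z => by rw [hPe, Even.neg_pow ⟨m, by ring⟩]) (C := C) (L := 2 * m + L)
    (τ := π * ∑ k ∈ Finset.range M, β k) (fun z => ?_) (fun x => ?_)
    (D := D) (κ := (2 * m : ℕ) + ∑ k ∈ Finset.range M, (1 - 2 * α k)) (fun x hx => ?_) ?_
    hlam0 hlam l
  · have hint : (fun x : ℝ => x ^ (2 * m) * besselJ (2 * l + 1) (lam * x) * gammaProd M α β x)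
        = fun x => besselJ (2 * l + 1) (lam * x) * (x ^ (2 * m) * gammaProd M α β x) := by
      ext x; ring
    rw [hint, key]
    congr 1
    rw [show l + 1 = m + (l - m + 1) by lia, Finset.sum_range_add,
      Finset.sum_eq_zero fun j hj => ?_, zero_add]
    · refine Finset.sum_congr rfl fun s hs => ?_
      have hs' := Finset.mem_range.mp hs
      rw [iteratedDeriv_pow_mul_zero hgs, if_pos (by lia),
        show 2 * (m + s) - 2 * m = 2 * s by lia,
        Nat.cast_choose ℝ (by lia : 2 * m ≤ 2 * (m + s)),
        show 2 * (m + s) - 2 * m = 2 * s by lia, show l + (m + s) = l + m + s by ring,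
        show l - (m + s) = l - m - s by lia, show 2 * (m + s) + 1 = 2 * m + 2 * s + 1 by ring]
      have h1 : ((2 * (m + s)).factorial : ℝ) ≠ 0 := by positivity
      have h2 : ((2 * m).factorial : ℝ) ≠ 0 := by positivity
      congr 2
      field_simp
    · have hj' := Finset.mem_range.mp hj
      rw [iteratedDeriv_pow_mul_zero hgs, if_neg (by lia)]
      simp
  · rw [norm_mul, norm_pow, pow_add, hP]
    calc _ ≤ (1 + ‖z‖) ^ (2 * m)
          * (C * (1 + ‖z‖) ^ L * rexp (π * (∑ k ∈ Finset.range M, β k) * |z.im|)) := by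
          gcongr
          · linarith
          · exact hC z
      _ = _ := by ring
  · rw [hPr]; push_cast; rfl
  · have h1 := hD x hx
    rw [← hP, hPr, Complex.norm_real, Real.norm_eq_abs] at h1
    rw [abs_mul, abs_of_nonneg (by positivity), Real.rpow_add (by positivity), Real.rpow_natCast]
    calc _ ≤ (1 + x) ^ (2 * m) * (D * (1 + x) ^ ∑ k ∈ Finset.range M, (1 - 2 * α k)) := by
          gcongr
          linarith
      _ = _ := by ring
  · rw [Finset.sum_sub_distrib, ← Finset.mul_sum, Finset.sum_const, Finset.card_range, nsmul_eq_mul,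
      mul_one]
    push_cast
    linarith
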